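/- arXiv:1107.2719 — 3 statements merged into one kernel-verified Lean document; each statement's English description precedes it below -/
import Mathlib

section
/- Fix c ∈ (0,∞) and let p(n) = c·n^{−1/2}. For each n, let A be a random subset of {0,1,…,n−1} in the binomial model with parameter p(n), and let S = |A+A| and D = |A−A|. Define g : (0,∞) → (0,2) by g(x) = 2(e^{−x} − (1−x))/x. Then S ∼ g(c²/2)·n and D ∼ g(c²)·n with probability tending to 1; that is, for every ε > 0, the probability that |S/(g(c²/2)·n) − 1| < ε and |D/(g(c²)·n) − 1| < ε tends to 1 as n → ∞. -/
open Finset Filter Asymptotics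
open scoped Pointwise Classical


/-- The probability, in the binomial model with parameter `p` on `{0,…,n-1}` (each element
included independently with probability `p`), of the event `P` of random subsets. -/
noncomputable def binomProb (n : ℕ) (p : ℝ) (P : Finset ℤ → Prop) : ℝ :=
  ∑ A ∈ (Finset.Icc (0 : ℤ) ((n : ℤ) - 1)).powerset,
    if P A then p ^ A.card * (1 - p) ^ (n - A.card) else 0

/-- `g(x) = 2(e^{-x} - (1-x))/x`. -/
noncomputable def gHM (x : ℝ) : ℝ := 2 * ((Real.exp (-x) - (1 - x)) / x)

noncomputable def Ex (X : Finset ℤ) (p : ℝ) (f : Finset ℤ → ℝ) : ℝ :=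
  ∑ A ∈ X.powerset, p ^ A.card * (1 - p) ^ (X.card - A.card) * f A

lemma Ex_congr {X : Finset ℤ} {p : ℝ} {f g : Finset ℤ → ℝ} (h : ∀ A, A ⊆ X → f A = g A) :
    Ex X p f = Ex X p g := by
  unfold Ex
  refine Finset.sum_congr rfl fun A hA => ?_
  rw [h A (Finset.mem_powerset.1 hA)]

lemma Ex_insert {X : Finset ℤ} {i : ℤ} (hi : i ∉ X) (p : ℝ) (f : Finset ℤ → ℝ) :
    Ex (insert i X) p f = p * Ex X p (fun A => f (insert i A)) + (1 - p) * Ex X p f := by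
  unfold Ex
  rw [Finset.sum_powerset_insert hi, add_comm, Finset.mul_sum, Finset.mul_sum]
  congr 1
  · refine Finset.sum_congr rfl fun A hA => ?_
    have hA' := Finset.mem_powerset.1 hA
    rw [Finset.card_insert_of_notMem hi, Finset.card_insert_of_notMem (fun h => hi (hA' h)),
      Nat.add_sub_add_right]
    ring
  · refine Finset.sum_congr rfl fun A hA => ?_
    have hA' := Finset.card_le_card (Finset.mem_powerset.1 hA)
    rw [Finset.card_insert_of_notMem hi, Nat.succ_sub hA', pow_succ]
    ring

lemma Ex_add (X : Finset ℤ) (p : ℝ) (f g : Finset ℤ → ℝ) :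
    Ex X p (fun A => f A + g A) = Ex X p f + Ex X p g := by
  unfold Ex
  rw [← Finset.sum_add_distrib]
  exact Finset.sum_congr rfl fun A _ => by ring

lemma Ex_sub (X : Finset ℤ) (p : ℝ) (f g : Finset ℤ → ℝ) :
    Ex X p (fun A => f A - g A) = Ex X p f - Ex X p g := by
  unfold Ex
  rw [← Finset.sum_sub_distrib]
  exact Finset.sum_congr rfl fun A _ => by ring

lemma Ex_mul (X : Finset ℤ) (p c : ℝ) (f : Finset ℤ → ℝ) :
    Ex X p (fun A => c * f A) = c * Ex X p f := by
  unfold Ex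
  rw [Finset.mul_sum]
  exact Finset.sum_congr rfl fun A _ => by ring

lemma Ex_sum {ι : Type*} (s : Finset ι) (X : Finset ℤ) (p : ℝ) (f : ι → Finset ℤ → ℝ) :
    Ex X p (fun A => ∑ i ∈ s, f i A) = ∑ i ∈ s, Ex X p (f i) := by
  unfold Ex
  rw [Finset.sum_comm]
  exact Finset.sum_congr rfl fun A _ => by rw [Finset.mul_sum]

lemma Ex_const (X : Finset ℤ) (p c : ℝ) : Ex X p (fun _ => c) = c := by
  induction X using Finset.induction_on with
  | empty => simp [Ex]
  | insert i X hi ih => rw [Ex_insert hi, ih]; ring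

lemma Ex_mono {X : Finset ℤ} {p : ℝ} (h0 : 0 ≤ p) (h1 : p ≤ 1) {f g : Finset ℤ → ℝ}
    (h : ∀ A, A ⊆ X → f A ≤ g A) : Ex X p f ≤ Ex X p g := by
  unfold Ex
  refine Finset.sum_le_sum fun A hA => ?_
  refine mul_le_mul_of_nonneg_left (h A (Finset.mem_powerset.1 hA)) ?_
  have : 0 ≤ 1 - p := by linarith
  positivity

lemma Ex_split {X : Finset ℤ} {i : ℤ} (hi : i ∈ X) (p : ℝ) (f : Finset ℤ → ℝ) :
    Ex X p f = p * Ex X p (fun A => f (insert i A)) + (1 - p) * Ex X p (fun A => f (A.erase i)) := by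
  have hX : X = insert i (X.erase i) := (Finset.insert_erase hi).symm
  have hn : i ∉ X.erase i := Finset.notMem_erase i X
  generalize X.erase i = Y at hX hn
  subst hX
  rw [Ex_insert hn, Ex_insert hn, Ex_insert hn]
  simp only [Finset.insert_idem]
  have e1 : Ex Y p (fun A => f ((insert i A).erase i)) = Ex Y p f :=
    Ex_congr fun A hA => by rw [Finset.erase_insert (fun h => hn (hA h))]
  have e2 : Ex Y p (fun A => f (A.erase i)) = Ex Y p f :=
    Ex_congr fun A hA => by rw [Finset.erase_eq_of_notMem (fun h => hn (hA h))]
  rw [e1, e2]; ring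

lemma Ex_sq_le {X : Finset ℤ} {p : ℝ} (h0 : 0 ≤ p) (h1 : p ≤ 1) (f : Finset ℤ → ℝ) :
    (Ex X p f) ^ 2 ≤ Ex X p (fun A => f A ^ 2) := by
  have h : 0 ≤ Ex X p (fun A => (f A - Ex X p f) ^ 2) := by
    rw [← Ex_const X p 0]
    exact Ex_mono h0 h1 fun A _ => sq_nonneg _
  have e : Ex X p (fun A => (f A - Ex X p f) ^ 2) =
      Ex X p (fun A => (f A ^ 2 - 2 * Ex X p f * f A) + (Ex X p f) ^ 2) :=
    Ex_congr fun A _ => by ring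
  rw [e, Ex_add, Ex_sub, Ex_mul, Ex_const] at h
  nlinarith

lemma efron_stein {p : ℝ} (h0 : 0 ≤ p) (h1 : p ≤ 1) (X : Finset ℤ) (f : Finset ℤ → ℝ) :
    Ex X p (fun A => f A ^ 2) - (Ex X p f) ^ 2 ≤
      p * ∑ i ∈ X, Ex X p (fun A => (f (insert i A) - f (A.erase i)) ^ 2) := by
  induction X using Finset.induction_on generalizing f with
  | empty => simp [Ex]
  | insert i Y hi ih =>
    have a1 := ih (fun A => f (insert i A))
    have a0 := ih f
    have hd := Ex_sq_le (X := Y) h0 h1 (fun A => f (insert i A) - f A)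
    rw [Ex_sub] at hd
    rw [Finset.sum_insert hi]
    have e1 : Ex (insert i Y) p (fun A => (f (insert i A) - f (A.erase i)) ^ 2) =
        Ex Y p (fun A => (f (insert i A) - f A) ^ 2) := by
      rw [Ex_insert hi]
      have : Ex Y p (fun A => (f (insert i (insert i A)) - f ((insert i A).erase i)) ^ 2) =
          Ex Y p (fun A => (f (insert i A) - f A) ^ 2) :=
        Ex_congr fun A hA => by
          rw [Finset.erase_insert (fun h => hi (hA h)), Finset.insert_idem]
      rw [this]
      have : Ex Y p (fun A => (f (insert i A) - f (A.erase i)) ^ 2) =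
          Ex Y p (fun A => (f (insert i A) - f A) ^ 2) :=
        Ex_congr fun A hA => by
          rw [Finset.erase_eq_of_notMem (fun h => hi (hA h))]
      rw [this]; ring
    have e2 : ∑ j ∈ Y, Ex (insert i Y) p (fun A => (f (insert j A) - f (A.erase j)) ^ 2) =
        p * ∑ j ∈ Y, Ex Y p (fun A => (f (insert i (insert j A)) - f (insert i (A.erase j))) ^ 2)
        + (1 - p) * ∑ j ∈ Y, Ex Y p (fun A => (f (insert j A) - f (A.erase j)) ^ 2) := by
      rw [Finset.mul_sum, Finset.mul_sum, ← Finset.sum_add_distrib]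
      refine Finset.sum_congr rfl fun j hj => ?_
      rw [Ex_insert hi]
      congr 2
      refine Ex_congr fun A hA => ?_
      have : i ≠ j := fun h => hi (h ▸ hj)
      rw [Finset.insert_comm, Finset.erase_insert_of_ne this]
    rw [e1, e2, Ex_insert hi, Ex_insert hi]
    set S1 := ∑ j ∈ Y, Ex Y p (fun A => (f (insert i (insert j A)) - f (insert i (A.erase j))) ^ 2)
    set S0 := ∑ j ∈ Y, Ex Y p (fun A => (f (insert j A) - f (A.erase j)) ^ 2)
    set D := Ex Y p (fun A => (f (insert i A) - f A) ^ 2)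
    set m1 := Ex Y p (fun A => f (insert i A))
    set m0 := Ex Y p f
    set q1 := Ex Y p (fun A => f (insert i A) ^ 2)
    set q0 := Ex Y p (fun A => f A ^ 2)
    have hq : 0 ≤ 1 - p := by linarith
    have b1 := mul_le_mul_of_nonneg_left a1 h0
    have b0 := mul_le_mul_of_nonneg_left a0 hq
    have b2 := mul_le_mul_of_nonneg_left hd (mul_nonneg h0 hq)
    have b3 : p * (1 - p) * D ≤ p * D := by
      have : 0 ≤ D := (sq_nonneg _).trans hd
      nlinarith [mul_nonneg (mul_nonneg h0 h0) this]
    nlinarith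

lemma Ex_mem {X : Finset ℤ} {i : ℤ} (hi : i ∈ X) (p : ℝ) :
    Ex X p (fun A => if i ∈ A then 1 else 0) = p := by
  rw [Ex_split hi]
  simp [Ex_const]

lemma Ex_card (X : Finset ℤ) (p : ℝ) : Ex X p (fun A => (A.card : ℝ)) = p * X.card := by
  have : Ex X p (fun A => (A.card : ℝ)) = Ex X p (fun A => ∑ i ∈ X, if i ∈ A then 1 else 0) := by
    refine Ex_congr fun A hA => ?_
    rw [Finset.sum_ite_mem, Finset.inter_eq_right.2 hA]; simp
  rw [this, Ex_sum, Finset.sum_congr rfl fun i hi => Ex_mem hi p]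
  simp [mul_comm]

lemma Ex_card_sq {p : ℝ} (h0 : 0 ≤ p) (h1 : p ≤ 1) (X : Finset ℤ) :
    Ex X p (fun A => (A.card : ℝ) ^ 2) ≤ p * X.card + (p * X.card) ^ 2 := by
  have h := efron_stein h0 h1 X (fun A => (A.card : ℝ))
  rw [Ex_card] at h
  have : ∑ i ∈ X, Ex X p (fun A => (((insert i A).card : ℝ) - ((A.erase i).card : ℝ)) ^ 2) ≤ X.card := by
    calc _ ≤ ∑ i ∈ X, (1 : ℝ) := by
          refine Finset.sum_le_sum fun i _ => ?_
          rw [← Ex_const X p 1]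
          refine Ex_mono h0 h1 fun A _ => ?_
          have : (insert i A).card = (A.erase i).card + 1 := by
            rw [← Finset.insert_erase (Finset.mem_insert_self i A), Finset.erase_insert_eq_erase,
              Finset.card_insert_of_notMem (Finset.notMem_erase _ _)]
          rw [this]; push_cast; norm_num
      _ = _ := by simp
  nlinarith [mul_le_mul_of_nonneg_left this h0]

lemma var_bound {p : ℝ} (h0 : 0 ≤ p) (h1 : p ≤ 1) (X : Finset ℤ) (f : Finset ℤ → ℝ)
    (hf : ∀ A i, |f (insert i A) - f (A.erase i)| ≤ 2 * (A.card : ℝ) + 1) :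
    Ex X p (fun A => f A ^ 2) - (Ex X p f) ^ 2 ≤
      p * X.card * (8 * (p * X.card + (p * X.card) ^ 2) + 2) := by
  refine (efron_stein h0 h1 X f).trans ?_
  rw [mul_assoc]
  refine mul_le_mul_of_nonneg_left ?_ h0
  calc _ ≤ ∑ i ∈ X, (8 * (p * X.card + (p * X.card) ^ 2) + 2) := by
        refine Finset.sum_le_sum fun i _ => ?_
        calc _ ≤ Ex X p (fun A => 8 * (A.card : ℝ) ^ 2 + 2) := by
              refine Ex_mono h0 h1 fun A _ => ?_
              have := hf A i
              rw [← sq_abs]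
              have h3 := pow_le_pow_left₀ (abs_nonneg _) this 2
              nlinarith [sq_nonneg (2 * (A.card : ℝ) - 1)]
          _ ≤ _ := by
              rw [Ex_add, Ex_mul, Ex_const]
              linarith [Ex_card_sq h0 h1 X]
    _ = _ := by rw [Finset.sum_const, nsmul_eq_mul]

lemma sq_dev {p : ℝ} (h0 : 0 ≤ p) (h1 : p ≤ 1) (X : Finset ℤ) (f : Finset ℤ → ℝ) (M : ℝ)
    (hf : ∀ A i, |f (insert i A) - f (A.erase i)| ≤ 2 * (A.card : ℝ) + 1) :
    Ex X p (fun A => (f A - M) ^ 2) ≤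
      p * X.card * (8 * (p * X.card + (p * X.card) ^ 2) + 2) + (Ex X p f - M) ^ 2 := by
  have h := var_bound h0 h1 X f hf
  have e : Ex X p (fun A => (f A - M) ^ 2) =
      Ex X p (fun A => (f A ^ 2 - 2 * M * f A) + M ^ 2) :=
    Ex_congr fun A _ => by ring
  rw [e, Ex_add, Ex_sub, Ex_mul, Ex_const]
  nlinarith

lemma pairs_bound {p : ℝ} (h0 : 0 ≤ p) (h1 : p ≤ 1) (X : Finset ℤ) (a b : ℕ → ℤ) (m : ℕ)
    (haX : ∀ j < m, a j ∈ X) (hbX : ∀ j < m, b j ∈ X)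
    (hab : ∀ i j, i ≤ j → j < m → b j ≠ a i)
    (ha : ∀ i j, i < j → j < m → a i ≠ a j) (hb : ∀ i j, i < j → j < m → b i ≠ b j) :
    (1 - p ^ 2) ^ m ≤ Ex X p (fun A => if ∀ j < m, ¬ (a j ∈ A ∧ b j ∈ A) then 1 else 0) ∧
    Ex X p (fun A => if ∀ j < m, ¬ (a j ∈ A ∧ b j ∈ A) then 1 else 0) ≤
      (1 - p ^ 2 * (1 - p)) ^ m := by
  induction m with
  | zero => simp [Ex_const]
  | succ m ih =>
    obtain ⟨ih1, ih2⟩ := ih (fun j hj => haX j (by omega)) (fun j hj => hbX j (by omega))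
      (fun i j h h' => hab i j h (by omega)) (fun i j h h' => ha i j h (by omega))
      (fun i j h h' => hb i j h (by omega))
    set F : Finset ℤ → ℝ := fun A => if ∀ j < m, ¬ (a j ∈ A ∧ b j ∈ A) then 1 else 0 with hF
    have hF0 : ∀ A, 0 ≤ F A := fun A => by simp only [hF]; split_ifs <;> norm_num
    have Fmono : ∀ A B : Finset ℤ, A ⊆ B → F B ≤ F A := by
      intro A B hAB
      simp only [hF]
      split_ifs with hB hA hA
      · norm_num
      · exact absurd (fun j hj h => hB j hj ⟨hAB h.1, hAB h.2⟩) hA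
      · norm_num
      · norm_num
    have hsplit : Ex X p (fun A => if ∀ j < m + 1, ¬ (a j ∈ A ∧ b j ∈ A) then 1 else 0) =
        Ex X p F - p * (p * Ex X p (fun A => F (insert (a m) A))) := by
      have e1 : Ex X p (fun A => if ∀ j < m + 1, ¬ (a j ∈ A ∧ b j ∈ A) then (1:ℝ) else 0) =
          Ex X p (fun A => F A - F A * (if a m ∈ A then 1 else 0) * (if b m ∈ A then 1 else 0)) := by
        refine Ex_congr fun A _ => ?_
        simp only [hF, Nat.forall_lt_succ_right]
        by_cases c1 : ∀ j < m, ¬ (a j ∈ A ∧ b j ∈ A) <;> by_cases c2 : a m ∈ A <;>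
          by_cases c3 : b m ∈ A <;> simp [*]
      rw [e1, Ex_sub]
      congr 1
      rw [Ex_split (hbX m (by omega))]
      have hne : a m ≠ b m := (hab m m le_rfl (by omega)).symm
      have e2 : Ex X p (fun A => F (insert (b m) A) * (if a m ∈ insert (b m) A then 1 else 0) *
          (if b m ∈ insert (b m) A then 1 else 0)) = Ex X p (fun A => F A * (if a m ∈ A then 1 else 0)) := by
        refine Ex_congr fun A _ => ?_
        have : F (insert (b m) A) = F A := by
          simp only [hF]
          congr 1
          refine propext (forall₂_congr fun j hj => ?_)
          have g1 : a j ≠ b m := (hab j m hj.le (by omega)).symm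
          have g2 : b j ≠ b m := hb j m hj (by omega)
          simp [g1, g2]
        rw [this]
        simp [hne]
      rw [e2, Ex_split (haX m (by omega))]
      simp [Ex_const]
    rw [hsplit]
    have hup : Ex X p (fun A => F (insert (a m) A)) ≤ Ex X p F :=
      Ex_mono h0 h1 fun A _ => Fmono _ _ (Finset.subset_insert _ _)
    have hlo : (1 - p) * Ex X p F ≤ Ex X p (fun A => F (insert (a m) A)) := by
      have hE0 : 0 ≤ Ex X p F := by
        rw [← Ex_const X p 0]; exact Ex_mono h0 h1 fun A _ => hF0 A
      by_cases hex : ∃ i < m, b i = a m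
      · obtain ⟨i, hi, hbi⟩ := hex
        calc (1 - p) * Ex X p F ≤ (1 - p) * Ex X p (fun A => F (A.erase (a i))) := by
              refine mul_le_mul_of_nonneg_left ?_ (by linarith)
              exact Ex_mono h0 h1 fun A _ => Fmono _ _ (Finset.erase_subset _ _)
          _ = Ex X p (fun A => F A * (if a i ∈ A then 0 else 1)) := by
              rw [Ex_split (haX i (by omega)) p (fun A => F A * (if a i ∈ A then 0 else 1))]
              simp [Ex_const]
          _ ≤ _ := by
              refine Ex_mono h0 h1 fun A _ => ?_
              by_cases h : a i ∈ A
              · simp [h, hF0]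
              · simp only [h, if_false, mul_one]
                simp only [hF]
                split_ifs with hA hB hB
                · norm_num
                · refine absurd (fun j hj hjj => ?_) hB
                  have g1 : a j ≠ a m := ha j m hj (by omega)
                  have g2 := Finset.mem_of_mem_insert_of_ne hjj.1 g1
                  rcases Finset.mem_insert.1 hjj.2 with g3 | g3
                  · have : j = i := by
                      by_contra hji
                      rcases lt_or_gt_of_ne hji with g | g
                      · exact hb j i g (by omega) (g3.trans hbi.symm)
                      · exact hb i j g (by omega) (g3.trans hbi.symm).symm
                    exact h (this ▸ g2)
                  · exact hA j hj ⟨g2, g3⟩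
                · norm_num
                · norm_num
      · push Not at hex
        calc (1 - p) * Ex X p F ≤ Ex X p F := by nlinarith
          _ ≤ _ := by
              refine Ex_mono h0 h1 fun A _ => ?_
              simp only [hF]
              split_ifs with hA hB hB
              · norm_num
              · refine absurd (fun j hj hjj => ?_) hB
                have g1 : a j ≠ a m := ha j m hj (by omega)
                exact hA j hj ⟨Finset.mem_of_mem_insert_of_ne hjj.1 g1,
                  Finset.mem_of_mem_insert_of_ne hjj.2 (hex j hj)⟩
              · norm_num
              · norm_num
    have hpp : 0 ≤ p * p := mul_nonneg h0 h0
    have k1 := mul_le_mul_of_nonneg_left hup hpp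
    have k2 := mul_le_mul_of_nonneg_left hlo hpp
    have s1 : 0 ≤ 1 - p ^ 2 := by nlinarith
    have s2 : 0 ≤ 1 - p ^ 2 * (1 - p) := by nlinarith [mul_nonneg hpp h0]
    constructor
    · rw [pow_succ]
      nlinarith [mul_le_mul_of_nonneg_right ih1 s1]
    · rw [pow_succ]
      nlinarith [mul_le_mul_of_nonneg_right ih2 s2]

lemma sum_lip (A : Finset ℤ) (i : ℤ) :
    |((insert i A + insert i A).card : ℝ) - ((A.erase i + A.erase i).card : ℝ)|
      ≤ 2 * (A.card : ℝ) + 1 := by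
  have e : insert i A = insert i (A.erase i) := by
    ext z; by_cases hz : z = i <;> simp [hz]
  have hB : (A.erase i).card ≤ A.card := Finset.card_le_card (Finset.erase_subset _ _)
  rw [e]
  generalize A.erase i = B at hB ⊢
  have h1 : (B + B).card ≤ (insert i B + insert i B).card :=
    Finset.card_le_card (Finset.add_subset_add (Finset.subset_insert _ _) (Finset.subset_insert _ _))
  have h2 : insert i B + insert i B ⊆ (B + B) ∪ (insert i B).image (fun x => i + x) := by
    intro z hz
    obtain ⟨x, hx, y, hy, rfl⟩ := Finset.mem_add.1 hz
    rw [Finset.mem_union, Finset.mem_image]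
    rcases Finset.mem_insert.1 hx with rfl | hx'
    · exact Or.inr ⟨y, hy, rfl⟩
    · rcases Finset.mem_insert.1 hy with rfl | hy'
      · exact Or.inr ⟨x, hx, add_comm _ _⟩
      · exact Or.inl (Finset.add_mem_add hx' hy')
  have h3 := (Finset.card_le_card h2).trans (Finset.card_union_le _ _)
  have h4 : ((insert i B).image (fun x => i + x)).card ≤ B.card + 1 :=
    Finset.card_image_le.trans (Finset.card_insert_le _ _)
  have h5 : (insert i B + insert i B).card ≤ (B + B).card + A.card + 1 := by omega
  have h1' : ((B + B).card : ℝ) ≤ (insert i B + insert i B).card := by exact_mod_cast h1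
  have h5' : ((insert i B + insert i B).card : ℝ) ≤ (B + B).card + A.card + 1 := by exact_mod_cast h5
  rw [abs_of_nonneg (by linarith)]
  have : (0 : ℝ) ≤ A.card := by positivity
  linarith

lemma diff_lip (A : Finset ℤ) (i : ℤ) :
    |((insert i A - insert i A).card : ℝ) - ((A.erase i - A.erase i).card : ℝ)|
      ≤ 2 * (A.card : ℝ) + 1 := by
  have e : insert i A = insert i (A.erase i) := by
    ext z; by_cases hz : z = i <;> simp [hz]
  have hB : (A.erase i).card ≤ A.card := Finset.card_le_card (Finset.erase_subset _ _)
  rw [e]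
  generalize A.erase i = B at hB ⊢
  have h1 : (B - B).card ≤ (insert i B - insert i B).card :=
    Finset.card_le_card (Finset.sub_subset_sub (Finset.subset_insert _ _) (Finset.subset_insert _ _))
  have h2 : insert i B - insert i B ⊆
      (B - B) ∪ (B.image (fun x => i - x) ∪ (insert i B).image (fun x => x - i)) := by
    intro z hz
    obtain ⟨x, hx, y, hy, rfl⟩ := Finset.mem_sub.1 hz
    rw [Finset.mem_union, Finset.mem_union, Finset.mem_image, Finset.mem_image]
    rcases Finset.mem_insert.1 hy with rfl | hy'
    · exact Or.inr (Or.inr ⟨x, hx, rfl⟩)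
    · rcases Finset.mem_insert.1 hx with rfl | hx'
      · exact Or.inr (Or.inl ⟨y, hy', rfl⟩)
      · exact Or.inl (Finset.sub_mem_sub hx' hy')
  have h3 := (Finset.card_le_card h2).trans (Finset.card_union_le _ _)
  have h3' := Finset.card_union_le (B.image (fun x => i - x)) ((insert i B).image (fun x => x - i))
  have h4 : ((insert i B).image (fun x => x - i)).card ≤ B.card + 1 :=
    Finset.card_image_le.trans (Finset.card_insert_le _ _)
  have h4' : (B.image (fun x => i - x)).card ≤ B.card := Finset.card_image_le
  have h5 : (insert i B - insert i B).card ≤ (B - B).card + 2 * A.card + 1 := by omega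
  have h1' : ((B - B).card : ℝ) ≤ (insert i B - insert i B).card := by exact_mod_cast h1
  have h5' : ((insert i B - insert i B).card : ℝ) ≤ (B - B).card + 2 * A.card + 1 := by
    exact_mod_cast h5
  rw [abs_of_nonneg (by linarith)]
  linarith

lemma sum_miss {p : ℝ} (h0 : 0 ≤ p) (h1 : p ≤ 1) (n m : ℕ) (k s : ℤ) (hk0 : 0 ≤ k)
    (hk1 : k ≤ 2 * n - 2) (hs0 : 0 ≤ s) (hs1 : k - n + 1 ≤ s) (hs : s = 0 ∨ s = k - n + 1)
    (hm1 : k - 2 * s ≤ 2 * m) (hm2 : 2 * m ≤ k - 2 * s + 1) :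
    (1 - p ^ 2) ^ m - p ≤
      Ex (Finset.Icc (0 : ℤ) ((n : ℤ) - 1)) p (fun A => if k ∈ A + A then 0 else 1) ∧
    Ex (Finset.Icc (0 : ℤ) ((n : ℤ) - 1)) p (fun A => if k ∈ A + A then 0 else 1) ≤
      (1 - p ^ 2 * (1 - p)) ^ m := by
  set X := Finset.Icc (0 : ℤ) ((n : ℤ) - 1) with hX
  obtain ⟨b1, b2⟩ := pairs_bound h0 h1 X (fun j => s + j) (fun j => k - s - j) m
    (fun j hj => by simp only [hX, Finset.mem_Icc]; omega)
    (fun j hj => by simp only [hX, Finset.mem_Icc]; omega)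
    (fun i j h h' => by omega)
    (fun i j h h' => by omega)
    (fun i j h h' => by omega)
  constructor
  · have hmem : k / 2 ∈ X := by simp only [hX, Finset.mem_Icc]; omega
    have := Ex_mem hmem p
    refine (sub_le_sub b1 this.le).trans ?_
    rw [← Ex_sub]
    refine Ex_mono h0 h1 fun A hA => ?_
    by_cases hk : k ∈ A + A
    · simp only [hk, if_true]
      by_cases h2 : k / 2 ∈ A
      · simp only [h2, if_true]; split_ifs <;> norm_num
      · have : ¬ ∀ j < m, ¬ (s + (j : ℤ) ∈ A ∧ k - s - (j : ℤ) ∈ A) := by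
          intro hcon
          have key : ∀ x y : ℤ, x ∈ A → y ∈ A → x + y = k → x ≤ y → False := by
            intro x y hx hy hxy hle
            have gx := hA hx
            have gy := hA hy
            simp only [hX, Finset.mem_Icc] at gx gy
            have hne : x ≠ y := by
              rintro rfl
              exact h2 (by rwa [show k / 2 = x by omega])
            refine hcon (x - s).toNat (by omega) ⟨?_, ?_⟩
            · rwa [show s + ((x - s).toNat : ℤ) = x by omega]
            · rwa [show k - s - ((x - s).toNat : ℤ) = y by omega]
          obtain ⟨x, hx, y, hy, hxy⟩ := Finset.mem_add.1 hk
          rcases le_total x y with h | h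
          · exact key x y hx hy hxy h
          · exact key y x hy hx (by omega) h
        simp only [this, h2, if_false]; norm_num
    · simp only [hk, if_false]
      split_ifs <;> norm_num
  · refine le_trans (Ex_mono h0 h1 fun A _ => ?_) b2
    by_cases hk : k ∈ A + A
    · simp only [hk, if_true]; split_ifs <;> norm_num
    · have : ∀ j < m, ¬ (s + (j : ℤ) ∈ A ∧ k - s - (j : ℤ) ∈ A) := by
        intro j _ h
        exact hk (Finset.mem_add.2 ⟨_, h.1, _, h.2, by ring⟩)
      simp only [hk, if_false]
      rw [if_pos this]

lemma diff_miss {p : ℝ} (h0 : 0 ≤ p) (h1 : p ≤ 1) (n j : ℕ) (hj : j < n) :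
    (1 - p ^ 2) ^ j ≤
      Ex (Finset.Icc (0 : ℤ) ((n : ℤ) - 1)) p (fun A => if (n : ℤ) - j ∈ A - A then 0 else 1) ∧
    Ex (Finset.Icc (0 : ℤ) ((n : ℤ) - 1)) p (fun A => if (n : ℤ) - j ∈ A - A then 0 else 1) ≤
      (1 - p ^ 2 * (1 - p)) ^ j := by
  set X := Finset.Icc (0 : ℤ) ((n : ℤ) - 1) with hX
  have b := pairs_bound h0 h1 X (fun i => (i : ℤ)) (fun i => n - j + i) j
    (fun j hj => by simp only [hX, Finset.mem_Icc]; omega)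
    (fun j hj => by simp only [hX, Finset.mem_Icc]; omega)
    (fun i j h h' => by omega)
    (fun i j h h' => by omega)
    (fun i j h h' => by omega)
  have e : Ex X p (fun A => if (n : ℤ) - j ∈ A - A then (0 : ℝ) else 1) =
      Ex X p (fun A => if ∀ i < j, ¬ ((i : ℤ) ∈ A ∧ (n : ℤ) - j + (i : ℤ) ∈ A) then 1 else 0) := by
    refine Ex_congr fun A hA => ?_
    by_cases hk : (n : ℤ) - j ∈ A - A
    · have : ¬ ∀ i < j, ¬ ((i : ℤ) ∈ A ∧ (n : ℤ) - j + (i : ℤ) ∈ A) := by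
        intro hcon
        obtain ⟨y, hy, x, hx, hxy⟩ := Finset.mem_sub.1 hk
        have gx := hA hx
        have gy := hA hy
        simp only [hX, Finset.mem_Icc] at gx gy
        refine hcon x.toNat (by omega) ⟨?_, ?_⟩
        · rwa [show (x.toNat : ℤ) = x by omega]
        · rwa [show (n : ℤ) - j + (x.toNat : ℤ) = y by omega]
      rw [if_pos hk, if_neg this]
    · have : ∀ i < j, ¬ ((i : ℤ) ∈ A ∧ (n : ℤ) - j + (i : ℤ) ∈ A) := by
        intro i _ h
        exact hk (Finset.mem_sub.2 ⟨_, h.2, _, h.1, by ring⟩)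
      rw [if_neg hk, if_pos this]
  rw [e]; exact b

lemma card_add_eq (n : ℕ) (hn : 0 < n) (A : Finset ℤ) (hA : A ⊆ Finset.Icc (0 : ℤ) ((n : ℤ) - 1)) :
    ((A + A).card : ℝ) = (2 * n - ∑ j ∈ Finset.range n, ((if (j : ℤ) ∈ A + A then 0 else 1) +
      (if 2 * (n : ℤ) - 2 - j ∈ A + A then 0 else 1))) - (if (n : ℤ) - 1 ∈ A + A then 1 else 0) := by
  have hsub : A + A ⊆ Finset.Icc (0 : ℤ) (2 * n - 2) := by
    intro z hz
    obtain ⟨x, hx, y, hy, rfl⟩ := Finset.mem_add.1 hz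
    have gx := hA hx
    have gy := hA hy
    simp only [Finset.mem_Icc] at gx gy ⊢
    omega
  generalize A + A = B at hsub ⊢
  have c1 : (B.card : ℝ) = ∑ k ∈ Finset.Icc (0 : ℤ) (2 * n - 2), if k ∈ B then (1 : ℝ) else 0 := by
    rw [Finset.sum_ite_mem, Finset.inter_eq_right.2 hsub]; simp
  have hu : Finset.Icc (0 : ℤ) (2 * n - 2) = Finset.Icc (0 : ℤ) (n - 1) ∪ Finset.Icc (n - 1 : ℤ) (2 * n - 2) := by
    ext z; simp only [Finset.mem_union, Finset.mem_Icc]; omega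
  have hi : Finset.Icc (0 : ℤ) (n - 1) ∩ Finset.Icc (n - 1 : ℤ) (2 * n - 2) = {(n : ℤ) - 1} := by
    ext z; simp only [Finset.mem_inter, Finset.mem_Icc, Finset.mem_singleton]; omega
  have hui := Finset.sum_union_inter (s₁ := Finset.Icc (0 : ℤ) (n - 1))
    (s₂ := Finset.Icc (n - 1 : ℤ) (2 * n - 2)) (f := fun k => if k ∈ B then (1 : ℝ) else 0)
  rw [← hu, hi, ← c1, Finset.sum_singleton] at hui
  have d1 : ∑ k ∈ Finset.Icc (0 : ℤ) (n - 1), (if k ∈ B then (1 : ℝ) else 0) =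
      ∑ j ∈ Finset.range n, (1 - if (j : ℤ) ∈ B then (0 : ℝ) else 1) := by
    refine Finset.sum_nbij' (fun k => k.toNat) (fun j => (j : ℤ)) ?_ ?_ ?_ ?_ ?_
    · intro k hk; simp only [Finset.mem_Icc, Finset.mem_range] at *; omega
    · intro k hk; simp only [Finset.mem_Icc, Finset.mem_range] at *; omega
    · intro k hk; simp only [Finset.mem_Icc] at *; omega
    · intro k hk; simp
    · intro k hk
      simp only [Finset.mem_Icc] at hk
      rw [show ((k.toNat : ℕ) : ℤ) = k by omega]
      split_ifs <;> norm_num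
  have d2 : ∑ k ∈ Finset.Icc (n - 1 : ℤ) (2 * n - 2), (if k ∈ B then (1 : ℝ) else 0) =
      ∑ j ∈ Finset.range n, (1 - if 2 * (n : ℤ) - 2 - (j : ℤ) ∈ B then (0 : ℝ) else 1) := by
    refine Finset.sum_nbij' (fun k => (2 * (n : ℤ) - 2 - k).toNat) (fun j => 2 * (n : ℤ) - 2 - (j : ℤ)) ?_ ?_ ?_ ?_ ?_
    · intro k hk; simp only [Finset.mem_Icc, Finset.mem_range] at *; omega
    · intro k hk; simp only [Finset.mem_Icc, Finset.mem_range] at *; omega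
    · intro k hk; simp only [Finset.mem_Icc] at *; omega
    · intro k hk; simp
    · intro k hk
      simp only [Finset.mem_Icc] at hk
      rw [show 2 * (n : ℤ) - 2 - (((2 * (n : ℤ) - 2 - k).toNat : ℕ) : ℤ) = k by omega]
      split_ifs <;> norm_num
  rw [d1, d2, Finset.sum_sub_distrib, Finset.sum_sub_distrib] at hui
  simp only [Finset.sum_const, Finset.card_range, nsmul_eq_mul, mul_one] at hui
  rw [Finset.sum_add_distrib]
  linarith

lemma card_sub_eq (n : ℕ) (A : Finset ℤ) (hA : A ⊆ Finset.Icc (0 : ℤ) ((n : ℤ) - 1)) :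
    ((A - A).card : ℝ) = (2 * n - ∑ j ∈ Finset.range n, ((if (n : ℤ) - j ∈ A - A then 0 else 1) +
      (if (n : ℤ) - j ∈ A - A then 0 else 1))) + (if (0 : ℤ) ∈ A - A then 1 else 0) := by
  have hsub : A - A ⊆ Finset.Icc (-n : ℤ) n := by
    intro z hz
    obtain ⟨x, hx, y, hy, rfl⟩ := Finset.mem_sub.1 hz
    have gx := hA hx
    have gy := hA hy
    simp only [Finset.mem_Icc] at gx gy ⊢
    omega
  have hneg : ∀ z : ℤ, -z ∈ A - A ↔ z ∈ A - A := by
    have : ∀ z : ℤ, z ∈ A - A → -z ∈ A - A := by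
      intro z hz
      obtain ⟨x, hx, y, hy, rfl⟩ := Finset.mem_sub.1 hz
      exact Finset.mem_sub.2 ⟨y, hy, x, hx, by ring⟩
    exact fun z => ⟨fun h => by simpa using this _ h, this z⟩
  generalize A - A = B at hsub hneg ⊢
  have c1 : (B.card : ℝ) = ∑ k ∈ Finset.Icc (-n : ℤ) n, if k ∈ B then (1 : ℝ) else 0 := by
    rw [Finset.sum_ite_mem, Finset.inter_eq_right.2 hsub]; simp
  have hu : Finset.Icc (-n : ℤ) n = insert 0 (Finset.Icc (1 : ℤ) n ∪ Finset.Icc (-n : ℤ) (-1)) := by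
    ext z; simp only [Finset.mem_union, Finset.mem_Icc, Finset.mem_insert]; omega
  have hd : Disjoint (Finset.Icc (1 : ℤ) n) (Finset.Icc (-n : ℤ) (-1)) := by
    rw [Finset.disjoint_left]; intro z; simp only [Finset.mem_Icc]; omega
  rw [hu, Finset.sum_insert (by simp), Finset.sum_union hd] at c1
  have d1 : ∑ k ∈ Finset.Icc (1 : ℤ) n, (if k ∈ B then (1 : ℝ) else 0) =
      ∑ j ∈ Finset.range n, (1 - if (n : ℤ) - j ∈ B then (0 : ℝ) else 1) := by
    refine Finset.sum_nbij' (fun k => ((n : ℤ) - k).toNat) (fun j => (n : ℤ) - j) ?_ ?_ ?_ ?_ ?_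
    · intro k hk; simp only [Finset.mem_Icc, Finset.mem_range] at *; omega
    · intro k hk; simp only [Finset.mem_Icc, Finset.mem_range] at *; omega
    · intro k hk; simp only [Finset.mem_Icc] at *; omega
    · intro k hk; simp
    · intro k hk
      simp only [Finset.mem_Icc] at hk
      rw [show (n : ℤ) - ((((n : ℤ) - k).toNat : ℕ) : ℤ) = k by omega]
      split_ifs <;> norm_num
  have d2 : ∑ k ∈ Finset.Icc (-n : ℤ) (-1), (if k ∈ B then (1 : ℝ) else 0) =
      ∑ k ∈ Finset.Icc (1 : ℤ) n, (if k ∈ B then (1 : ℝ) else 0) := by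
    refine Finset.sum_nbij' (fun k => -k) (fun k => -k) ?_ ?_ ?_ ?_ ?_
    · intro k hk; simp only [Finset.mem_Icc] at *; omega
    · intro k hk; simp only [Finset.mem_Icc] at *; omega
    · intro k hk; simp
    · intro k hk; simp
    · intro k hk; simp only [hneg]
  rw [d2, d1, Finset.sum_sub_distrib] at c1
  simp only [Finset.sum_const, Finset.card_range, nsmul_eq_mul, mul_one] at c1
  rw [Finset.sum_add_distrib]
  linarith

lemma tendsto_of_scaled {s : ℕ → ℝ} {y : ℝ}
    (h : Tendsto (fun n : ℕ => (n : ℝ) * (1 - s n)) atTop (nhds y)) :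
    Tendsto s atTop (nhds 1) := by
  have h2 := h.mul tendsto_one_div_atTop_nhds_zero_nat
  have h3 := h2.const_sub 1
  simp only [mul_zero, sub_zero] at h3
  refine h3.congr' ?_
  filter_upwards [eventually_gt_atTop 0] with n hn
  have : (n : ℝ) ≠ 0 := by positivity
  field_simp
  ring

lemma geo_tendsto {s : ℕ → ℝ} {y : ℝ} (hy : 0 < y)
    (h : Tendsto (fun n : ℕ => (n : ℝ) * (1 - s n)) atTop (nhds y)) :
    Tendsto (fun n : ℕ => (∑ j ∈ Finset.range n, s n ^ j) / n) atTop
      (nhds ((1 - Real.exp (-y)) / y)) := by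
  have h1 : Tendsto (fun n : ℕ => (1 + (s n - 1)) ^ n) atTop (nhds (Real.exp (-y))) := by
    apply Real.tendsto_one_add_pow_exp_of_tendsto
    refine h.neg.congr fun n => by ring
  refine ((h1.const_sub 1).div h hy.ne').congr' ?_
  filter_upwards [h.eventually_ne hy.ne', eventually_gt_atTop 0] with n hn hn0
  have : (n : ℝ) ≠ 0 := by positivity
  have h2 : 1 - s n ≠ 0 := right_ne_zero_of_mul hn
  have h3 : s n ≠ 1 := fun h => h2 (by rw [h]; ring)
  have h4 : s n - 1 ≠ 0 := sub_ne_zero.2 h3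
  have e : (1 + (s n - 1)) = s n := by ring
  simp only [Pi.div_apply]
  rw [geom_sum_eq h3, e, div_div, div_eq_div_iff (by positivity) (by positivity)]
  ring

lemma mean_tendsto {E δ p l u : ℕ → ℝ} {μ ν : ℕ → ℕ → ℝ} {y : ℝ} (hy : 0 < y)
    (hp : Tendsto p atTop (nhds 0))
    (hl : Tendsto (fun n : ℕ => (n : ℝ) * (1 - l n)) atTop (nhds y))
    (hu : Tendsto (fun n : ℕ => (n : ℝ) * (1 - u n)) atTop (nhds y))
    (hE : ∀ᶠ n in atTop, E n = (2 * n - ∑ j ∈ Finset.range n, (μ n j + ν n j)) + δ n ∧ |δ n| ≤ 1 ∧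
      (∀ j < n, l n * l n ^ j - p n ≤ μ n j ∧ μ n j ≤ u n ^ j) ∧
      (∀ j < n, l n * l n ^ j - p n ≤ ν n j ∧ ν n j ≤ u n ^ j)) :
    Tendsto (fun n : ℕ => E n / n) atTop (nhds (gHM y)) := by
  have hg : gHM y = 2 - 2 * ((1 - Real.exp (-y)) / y) := by
    unfold gHM; field_simp; ring
  have hone := tendsto_one_div_atTop_nhds_zero_nat (𝕜 := ℝ)
  have t1 : Tendsto (fun n : ℕ => 2 - 2 * ((∑ j ∈ Finset.range n, u n ^ j) / n) - 1 / (n : ℝ))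
      atTop (nhds (gHM y)) := by
    have := (((geo_tendsto hy hu).const_mul 2).const_sub 2).sub hone
    rwa [sub_zero, ← hg] at this
  have t2 : Tendsto (fun n : ℕ => 2 - 2 * (l n * ((∑ j ∈ Finset.range n, l n ^ j) / n)) +
      2 * p n + 1 / (n : ℝ)) atTop (nhds (gHM y)) := by
    have := (((((tendsto_of_scaled hl).mul (geo_tendsto hy hl)).const_mul 2).const_sub 2).add
      (hp.const_mul 2)).add hone
    rwa [mul_zero, add_zero, add_zero, one_mul, ← hg] at this
  refine tendsto_of_tendsto_of_tendsto_of_le_of_le' t1 t2 ?_ ?_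
  · filter_upwards [hE, eventually_gt_atTop 0] with n hn hn0
    obtain ⟨h1, h2, h3, h4⟩ := hn
    have hn0' : (0 : ℝ) < n := by positivity
    rw [le_div_iff₀ hn0', h1]
    have : ∑ j ∈ Finset.range n, (μ n j + ν n j) ≤ 2 * ∑ j ∈ Finset.range n, u n ^ j := by
      rw [Finset.mul_sum]
      refine Finset.sum_le_sum fun j hj => ?_
      have hj := Finset.mem_range.1 hj
      linarith [(h3 j hj).2, (h4 j hj).2]
    have e : (2 - 2 * ((∑ j ∈ Finset.range n, u n ^ j) / n) - 1 / (n : ℝ)) * n =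
        2 * n - 2 * (∑ j ∈ Finset.range n, u n ^ j) - 1 := by field_simp
    rw [e]
    linarith [(abs_le.1 h2).1]
  · filter_upwards [hE, eventually_gt_atTop 0] with n hn hn0
    obtain ⟨h1, h2, h3, h4⟩ := hn
    have hn0' : (0 : ℝ) < n := by positivity
    rw [div_le_iff₀ hn0', h1]
    have : 2 * (l n * ∑ j ∈ Finset.range n, l n ^ j) - 2 * p n * n ≤
        ∑ j ∈ Finset.range n, (μ n j + ν n j) := by
      have e : 2 * (l n * ∑ j ∈ Finset.range n, l n ^ j) - 2 * p n * n =
          ∑ j ∈ Finset.range n, (2 * (l n * l n ^ j) - 2 * p n) := by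
        rw [Finset.sum_sub_distrib, Finset.mul_sum, Finset.mul_sum]
        simp [mul_comm]
      rw [e]
      refine Finset.sum_le_sum fun j hj => ?_
      have hj := Finset.mem_range.1 hj
      linarith [(h3 j hj).1, (h4 j hj).1]
    have e : (2 - 2 * (l n * ((∑ j ∈ Finset.range n, l n ^ j) / n)) + 2 * p n + 1 / (n : ℝ)) * n =
        2 * n - 2 * (l n * (∑ j ∈ Finset.range n, l n ^ j)) + 2 * p n * n + 1 := by field_simp
    rw [e]
    linarith [(abs_le.1 h2).2]

lemma sqrt_scaled {q : ℕ → ℝ} {y : ℝ} (hq0 : ∀ᶠ n in atTop, q n ≤ 1)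
    (h : Tendsto (fun n : ℕ => (n : ℝ) * q n) atTop (nhds y)) :
    Tendsto (fun n : ℕ => (n : ℝ) * (1 - Real.sqrt (1 - q n))) atTop (nhds (y / 2)) := by
  have h1 : Tendsto (fun n => 1 - q n) atTop (nhds 1) :=
    tendsto_of_scaled (h.congr fun n => by ring)
  have h2 : Tendsto (fun n => 1 + Real.sqrt (1 - q n)) atTop (nhds 2) := by
    have := (h1.sqrt).const_add 1
    rw [Real.sqrt_one] at this
    convert this using 2; norm_num
  refine (h.div h2 (by norm_num)).congr' ?_
  filter_upwards [hq0] with n hn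
  have := Real.sq_sqrt (sub_nonneg.2 hn)
  have h3 : 0 < 1 + Real.sqrt (1 - q n) := by positivity
  simp only [Pi.div_apply]
  rw [div_eq_iff h3.ne']
  have e : (n : ℝ) * (1 - √(1 - q n)) * (1 + √(1 - q n)) = n * (1 - √(1 - q n) ^ 2) := by ring
  rw [e, this]; ring

lemma g_pos {y : ℝ} (hy : 0 < y) : 0 < gHM y := by
  unfold gHM
  have := Real.add_one_lt_exp (neg_ne_zero.2 hy.ne')
  have : 0 < Real.exp (-y) - (1 - y) := by linarith
  positivity

lemma dev_tendsto {p : ℕ → ℝ} {c L : ℝ} (hL : 0 < L) (hpr : ∀ᶠ n in atTop, 0 ≤ p n ∧ p n ≤ 1)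
    (hpn : ∀ᶠ n : ℕ in atTop, (n : ℝ) * p n ^ 2 = c ^ 2)
    (hp : Tendsto p atTop (nhds 0)) (f : Finset ℤ → ℝ)
    (hf : ∀ A i, |f (insert i A) - f (A.erase i)| ≤ 2 * (A.card : ℝ) + 1)
    (hm : Tendsto (fun n : ℕ => Ex (Finset.Icc (0 : ℤ) ((n : ℤ) - 1)) (p n) f / n) atTop (nhds L)) :
    Tendsto (fun n : ℕ => Ex (Finset.Icc (0 : ℤ) ((n : ℤ) - 1)) (p n)
      (fun A => (f A / (L * n) - 1) ^ 2)) atTop (nhds 0) := by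
  have hup : Tendsto (fun n : ℕ => (1 / L ^ 2) * (8 * p n ^ 2 + 8 * (c ^ 2 * p n) + 2 * p n * (1 / (n : ℝ))
      + (Ex (Finset.Icc (0 : ℤ) ((n : ℤ) - 1)) (p n) f / n - L) ^ 2)) atTop (nhds 0) := by
    have hone := tendsto_one_div_atTop_nhds_zero_nat (𝕜 := ℝ)
    have := ((((((hp.pow 2).const_mul 8).add ((hp.const_mul (c ^ 2)).const_mul 8)).add
      ((hp.const_mul 2).mul hone)).add ((hm.sub_const L).pow 2)).const_mul (1 / L ^ 2))
    convert this using 2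
    simp
  refine tendsto_of_tendsto_of_tendsto_of_le_of_le' tendsto_const_nhds hup ?_ ?_
  · filter_upwards [hpr] with n hn
    rw [← Ex_const (Finset.Icc (0 : ℤ) ((n : ℤ) - 1)) (p n) 0]
    exact Ex_mono hn.1 hn.2 fun A _ => sq_nonneg _
  · filter_upwards [hpr, hpn, eventually_gt_atTop 0] with n hn hc hn0
    have hn0' : (0 : ℝ) < n := by positivity
    have h := sq_dev hn.1 hn.2 (Finset.Icc (0 : ℤ) ((n : ℤ) - 1)) f (L * n) hf
    have hcard : (Finset.Icc (0 : ℤ) ((n : ℤ) - 1)).card = n := by simp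
    rw [hcard] at h
    have e : Ex (Finset.Icc (0 : ℤ) ((n : ℤ) - 1)) (p n) (fun A => (f A / (L * n) - 1) ^ 2) =
        (1 / (L * n) ^ 2) * Ex (Finset.Icc (0 : ℤ) ((n : ℤ) - 1)) (p n) (fun A => (f A - L * n) ^ 2) := by
      rw [← Ex_mul]
      refine Ex_congr fun A _ => ?_
      field_simp
    rw [e]
    refine (mul_le_mul_of_nonneg_left h (by positivity)).trans (le_of_eq ?_)
    rw [← hc]
    field_simp

lemma binomProb_eq (n : ℕ) (p : ℝ) (P : Finset ℤ → Prop) :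
    binomProb n p P = Ex (Finset.Icc (0 : ℤ) ((n : ℤ) - 1)) p (fun A => if P A then 1 else 0) := by
  unfold binomProb Ex
  refine Finset.sum_congr rfl fun A _ => ?_
  have hcard : (Finset.Icc (0 : ℤ) ((n : ℤ) - 1)).card = n := by simp
  rw [hcard]
  by_cases h : P A <;> beta_reduce
  · rw [if_pos h, if_pos h, mul_one]
  · rw [if_neg h, if_neg h, mul_zero]

lemma Ex_ind_abs {p : ℝ} (h0 : 0 ≤ p) (h1 : p ≤ 1) (X : Finset ℤ) (P : Finset ℤ → Prop)
    [DecidablePred P] : |Ex X p (fun A => if P A then 1 else 0)| ≤ 1 := by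
  rw [abs_le]
  constructor
  · rw [← Ex_const X p (-1)]
    exact Ex_mono h0 h1 fun A _ => by split_ifs <;> norm_num
  · conv_rhs => rw [← Ex_const X p 1]
    exact Ex_mono h0 h1 fun A _ => by split_ifs <;> norm_num

lemma half_pow {r : ℝ} (h0 : 0 ≤ r) (h1 : r ≤ 1) (j m : ℕ) (h : j ≤ 2 * m) :
    r ^ m ≤ Real.sqrt r ^ j := by
  have : r ^ m = Real.sqrt r ^ (2 * m) := by rw [pow_mul, Real.sq_sqrt h0]
  rw [this]
  exact pow_le_pow_of_le_one (Real.sqrt_nonneg _) (Real.sqrt_le_one.2 h1) h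

lemma half_pow' {r : ℝ} (h0 : 0 ≤ r) (h1 : r ≤ 1) (j m : ℕ) (h : 2 * m ≤ j + 1) :
    Real.sqrt r * Real.sqrt r ^ j ≤ r ^ m := by
  have : r ^ m = Real.sqrt r ^ (2 * m) := by rw [pow_mul, Real.sq_sqrt h0]
  rw [this, ← pow_succ']
  exact pow_le_pow_of_le_one (Real.sqrt_nonneg _) (Real.sqrt_le_one.2 h1) h

/-- Hegarty–Miller, case (ii): if `p(n) = c·n^{-1/2}`, then with probability tending to 1,
`|A+A| ∼ g(c²/2)·n` and `|A-A| ∼ g(c²)·n`. -/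
theorem sum_diff_asymptotics_critical (c : ℝ) (hc : 0 < c) (p : ℕ → ℝ)
    (hp : ∀ n : ℕ, p n = c * ((n : ℝ)) ^ (-(1 / 2) : ℝ)) :
    ∀ ε : ℝ, 0 < ε →
      Filter.Tendsto
        (fun n : ℕ => binomProb n (p n) (fun A =>
          |((A + A).card : ℝ) / (gHM (c ^ 2 / 2) * n) - 1| < ε ∧
          |((A - A).card : ℝ) / (gHM (c ^ 2) * n) - 1| < ε))
        Filter.atTop (nhds 1) := by
  intro ε hε
  have hpt : Tendsto p atTop (nhds 0) := by
    have := ((tendsto_rpow_neg_atTop (y := 1 / 2) (by norm_num)).comp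
      (tendsto_natCast_atTop_atTop (R := ℝ))).const_mul c
    rw [mul_zero] at this
    exact this.congr fun n => (hp n).symm
  have hpr : ∀ᶠ n in atTop, 0 ≤ p n ∧ p n ≤ 1 := by
    filter_upwards [hpt.eventually_le_const (show (0 : ℝ) < 1 by norm_num)] with n hn
    exact ⟨by rw [hp]; positivity, hn⟩
  have hpn : ∀ᶠ n : ℕ in atTop, (n : ℝ) * p n ^ 2 = c ^ 2 := by
    filter_upwards [eventually_gt_atTop 0] with n hn
    have hn0' : (0 : ℝ) < n := by positivity
    rw [hp, mul_pow, ← Real.rpow_natCast ((n : ℝ) ^ (-(1 / 2) : ℝ)) 2, ← Real.rpow_mul hn0'.le]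
    norm_num
    rw [Real.rpow_neg_one]
    field_simp
  have q1 : Tendsto (fun n : ℕ => (n : ℝ) * p n ^ 2) atTop (nhds (c ^ 2)) :=
    tendsto_const_nhds.congr' (hpn.mono fun n h => h.symm)
  have q2 : Tendsto (fun n : ℕ => (n : ℝ) * (p n ^ 2 * (1 - p n))) atTop (nhds (c ^ 2)) := by
    have := q1.mul (hpt.const_sub 1)
    rw [sub_zero, mul_one] at this
    exact this.congr fun n => by ring
  have r1 : ∀ᶠ n in atTop, 0 ≤ 1 - p n ^ 2 ∧ 1 - p n ^ 2 ≤ 1 := by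
    filter_upwards [hpr] with n hn
    constructor <;> nlinarith [hn.1, hn.2]
  have r2 : ∀ᶠ n in atTop, 0 ≤ 1 - p n ^ 2 * (1 - p n) ∧ 1 - p n ^ 2 * (1 - p n) ≤ 1 := by
    filter_upwards [hpr] with n hn
    have k1 := pow_nonneg hn.1 3
    have k2 := mul_nonneg (pow_nonneg hn.1 2) (sub_nonneg.2 hn.2)
    constructor <;> nlinarith [hn.1, hn.2]
  have hc2 : 0 < c ^ 2 := by positivity
  have mS : Tendsto (fun n : ℕ => Ex (Finset.Icc (0 : ℤ) ((n : ℤ) - 1)) (p n)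
      (fun A => ((A + A).card : ℝ)) / n) atTop (nhds (gHM (c ^ 2 / 2))) := by
    refine mean_tendsto (p := p) (l := fun n => Real.sqrt (1 - p n ^ 2))
      (u := fun n => Real.sqrt (1 - p n ^ 2 * (1 - p n)))
      (μ := fun n j => Ex (Finset.Icc (0 : ℤ) ((n : ℤ) - 1)) (p n)
        (fun A => if (j : ℤ) ∈ A + A then 0 else 1))
      (ν := fun n j => Ex (Finset.Icc (0 : ℤ) ((n : ℤ) - 1)) (p n)
        (fun A => if 2 * (n : ℤ) - 2 - j ∈ A + A then 0 else 1))
      (δ := fun n => - Ex (Finset.Icc (0 : ℤ) ((n : ℤ) - 1)) (p n)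
        (fun A => if (n : ℤ) - 1 ∈ A + A then 1 else 0)) (by positivity) hpt
      (sqrt_scaled (r1.mono fun n h => by linarith [h.1]) q1)
      (sqrt_scaled (r2.mono fun n h => by linarith [h.1]) q2) ?_
    filter_upwards [hpr, r1, r2, eventually_gt_atTop 0] with n hn hr1 hr2 hn0
    refine ⟨?_, ?_, fun j hj => ?_, fun j hj => ?_⟩
    · rw [Ex_congr (fun A hA => card_add_eq n hn0 A hA), Ex_sub, Ex_sub, Ex_const, Ex_sum,
        sub_eq_add_neg]
      simp only [Ex_add]
    · rw [abs_neg]; exact Ex_ind_abs hn.1 hn.2 _ _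
    · obtain ⟨a1, a2⟩ := sum_miss hn.1 hn.2 n ((j + 1) / 2) j 0 (by omega) (by omega) (by omega)
        (by omega) (by omega) (by omega) (by omega)
      exact ⟨(sub_le_sub_right (half_pow' hr1.1 hr1.2 _ _ (by omega)) _).trans a1,
        a2.trans (half_pow hr2.1 hr2.2 _ _ (by omega))⟩
    · obtain ⟨a1, a2⟩ := sum_miss hn.1 hn.2 n ((j + 1) / 2) (2 * (n : ℤ) - 2 - j) (n - 1 - j)
        (by omega) (by omega) (by omega) (by omega) (by omega) (by omega) (by omega)
      exact ⟨(sub_le_sub_right (half_pow' hr1.1 hr1.2 _ _ (by omega)) _).trans a1,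
        a2.trans (half_pow hr2.1 hr2.2 _ _ (by omega))⟩
  have mD : Tendsto (fun n : ℕ => Ex (Finset.Icc (0 : ℤ) ((n : ℤ) - 1)) (p n)
      (fun A => ((A - A).card : ℝ)) / n) atTop (nhds (gHM (c ^ 2))) := by
    refine mean_tendsto (p := p) (l := fun n => 1 - p n ^ 2)
      (u := fun n => 1 - p n ^ 2 * (1 - p n))
      (μ := fun n j => Ex (Finset.Icc (0 : ℤ) ((n : ℤ) - 1)) (p n)
        (fun A => if (n : ℤ) - j ∈ A - A then 0 else 1))
      (ν := fun n j => Ex (Finset.Icc (0 : ℤ) ((n : ℤ) - 1)) (p n)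
        (fun A => if (n : ℤ) - j ∈ A - A then 0 else 1))
      (δ := fun n => Ex (Finset.Icc (0 : ℤ) ((n : ℤ) - 1)) (p n)
        (fun A => if (0 : ℤ) ∈ A - A then 1 else 0)) hc2 hpt
      (q1.congr fun n => by ring) (q2.congr fun n => by ring) ?_
    filter_upwards [hpr, r1, r2, eventually_gt_atTop 0] with n hn hr1 hr2 hn0
    have key : ∀ j < n, (1 - p n ^ 2) * (1 - p n ^ 2) ^ j - p n ≤
        Ex (Finset.Icc (0 : ℤ) ((n : ℤ) - 1)) (p n) (fun A => if (n : ℤ) - j ∈ A - A then 0 else 1) ∧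
        Ex (Finset.Icc (0 : ℤ) ((n : ℤ) - 1)) (p n) (fun A => if (n : ℤ) - j ∈ A - A then 0 else 1) ≤
        (1 - p n ^ 2 * (1 - p n)) ^ j := by
      intro j hj
      obtain ⟨a1, a2⟩ := diff_miss hn.1 hn.2 n j hj
      refine ⟨le_trans ?_ a1, a2⟩
      have := mul_le_of_le_one_left (pow_nonneg hr1.1 j) hr1.2
      linarith [hn.1]
    refine ⟨?_, ?_, key, key⟩
    · rw [Ex_congr (fun A hA => card_sub_eq n A hA), Ex_add, Ex_sub, Ex_const, Ex_sum]
      simp only [Ex_add]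
    · exact Ex_ind_abs hn.1 hn.2 _ _
  have dS := dev_tendsto (g_pos (by positivity)) hpr hpn hpt
    (fun A => ((A + A).card : ℝ)) sum_lip mS
  have dD := dev_tendsto (g_pos hc2) hpr hpn hpt
    (fun A => ((A - A).card : ℝ)) diff_lip mD
  have hlow := ((dS.const_mul (1 / ε ^ 2)).const_sub 1).sub (dD.const_mul (1 / ε ^ 2))
  simp only [mul_zero, sub_zero] at hlow
  refine tendsto_of_tendsto_of_tendsto_of_le_of_le' hlow tendsto_const_nhds ?_ ?_
  · filter_upwards [hpr] with n hn
    have hone := Ex_const (Finset.Icc (0 : ℤ) ((n : ℤ) - 1)) (p n) 1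
    rw [binomProb_eq, ← Ex_mul, ← Ex_mul]
    refine le_trans (le_of_eq (congrArg (fun t => t - _ - _) hone.symm)) ?_
    beta_reduce
    rw [← Ex_sub, ← Ex_sub]
    refine Ex_mono hn.1 hn.2 fun A _ => ?_
    have key : ∀ x : ℝ, 0 ≤ 1 / ε ^ 2 * x ^ 2 ∧ (¬ |x| < ε → 1 ≤ 1 / ε ^ 2 * x ^ 2) := by
      intro x
      refine ⟨by positivity, fun h => ?_⟩
      have := pow_le_pow_left₀ hε.le (not_lt.1 h) 2
      rw [sq_abs] at this
      rw [one_div_mul_eq_div, le_div_iff₀ (by positivity)]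
      linarith
    obtain ⟨k1, k2⟩ := key (((A + A).card : ℝ) / (gHM (c ^ 2 / 2) * n) - 1)
    obtain ⟨k3, k4⟩ := key (((A - A).card : ℝ) / (gHM (c ^ 2) * n) - 1)
    split_ifs with h
    · linarith
    · rcases not_and_or.1 h with h | h
      · linarith [k2 h]
      · linarith [k4 h]
  · filter_upwards [hpr] with n hn
    rw [binomProb_eq]
    exact (abs_le.1 (@Ex_ind_abs _ hn.1 hn.2 _ _ (fun _ => Classical.propDecidable _))).2
end

section
/- For each nonzero integer k there is a finite set A ⊆ {0, 1, …, 157|k|} such that |2A+2A| − |2A−2A| = k, where 2A = A+A; moreover, for |k| sufficiently large one may take A ⊆ {0, 1, …, 35|k|}. -/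
open Finset
open scoped Pointwise

theorem aux_split (p q r s x : ℤ) (h1 : p ≤ q) (h2 : r ≤ s) (h3 : p + r ≤ x) (h4 : x ≤ q + s) :
    ∃ y z : ℤ, p ≤ y ∧ y ≤ q ∧ r ≤ z ∧ z ≤ s ∧ y + z = x := by
  refine ⟨max p (x - s), x - max p (x - s), ?_, ?_, ?_, ?_, ?_⟩ <;> omega

theorem aux_mem_add {A B : Finset ℤ} (p q r s x : ℤ) (hA : ∀ y, p ≤ y → y ≤ q → y ∈ A)
    (hB : ∀ y, r ≤ y → y ≤ s → y ∈ B) (h1 : p ≤ q) (h2 : r ≤ s) (h3 : p + r ≤ x)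
    (h4 : x ≤ q + s) : x ∈ A + B := by
  obtain ⟨y, z, a, b, c, d, e⟩ := aux_split p q r s x h1 h2 h3 h4
  exact Finset.mem_add.2 ⟨y, hA y a b, z, hB z c d, e⟩

theorem aux_mem_sub {A B : Finset ℤ} (p q r s x : ℤ) (hA : ∀ y, p ≤ y → y ≤ q → y ∈ A)
    (hB : ∀ y, r ≤ y → y ≤ s → y ∈ B) (h1 : p ≤ q) (h2 : r ≤ s) (h3 : p - s ≤ x)
    (h4 : x ≤ q - r) : x ∈ A - B := by
  obtain ⟨y, z, a, b, c, d, e⟩ := aux_split p q (-s) (-r) x h1 (by omega) (by omega) (by omega)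
  exact Finset.mem_sub.2 ⟨y, hA y a b, -z, hB (-z) (by omega) (by omega), by omega⟩

/-- The negative case. -/
theorem aux_neg (k : ℤ) (hk : 1 ≤ k) : ∃ A : Finset ℤ, A ⊆ Finset.Icc 0 (3 * k) ∧
      (((A + A) + (A + A)).card : ℤ) - (((A + A) - (A + A)).card : ℤ) = -k := by
  set A : Finset ℤ := Icc 0 0 ∪ Icc (k + 1) (3 * k) with hAdef
  have mA : ∀ x, x ∈ A ↔ x = 0 ∨ (k + 1 ≤ x ∧ x ≤ 3 * k) := by
    intro x; simp only [hAdef, mem_union, mem_Icc]; omega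
  have mB : ∀ x, x ∈ A + A ↔ x = 0 ∨ (k + 1 ≤ x ∧ x ≤ 6 * k) := by
    intro x
    constructor
    · intro h
      obtain ⟨y, hy, z, hz, e⟩ := Finset.mem_add.1 h
      rw [mA] at hy hz; omega
    · intro h
      by_cases h1 : x ≤ 3 * k
      · exact Finset.mem_add.2 ⟨x, (mA _).2 (by omega), 0, (mA _).2 (by omega), by omega⟩
      · exact aux_mem_add (k + 1) (3 * k) (k + 1) (3 * k) x
          (fun y _ _ => (mA _).2 (by omega)) (fun y _ _ => (mA _).2 (by omega))
          (by omega) (by omega) (by omega) (by omega)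
  have hsub : A ⊆ Icc 0 (3 * k) := by
    intro x hx
    rw [mA] at hx; rw [mem_Icc]; omega
  refine ⟨A, hsub, ?_⟩
  clear_value A
  generalize A + A = B at mB
  have i0 : ∀ y, 0 ≤ y → y ≤ 0 → y ∈ B := fun y _ _ => (mB y).2 (by omega)
  have i1 : ∀ y, k + 1 ≤ y → y ≤ 6 * k → y ∈ B := fun y _ _ => (mB y).2 (by omega)
  have e1 : B + B = Icc 0 0 ∪ Icc (k + 1) (12 * k) := by
    ext x
    simp only [mem_union, mem_Icc]
    constructor
    · intro h
      obtain ⟨y, hy, z, hz, e⟩ := Finset.mem_add.1 h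
      rw [mB] at hy hz
      omega
    · rintro (h | h)
      · exact aux_mem_add _ _ _ _ x i0 i0 (by omega) (by omega) (by omega) (by omega)
      by_cases h1 : x ≤ 6 * k
      · exact aux_mem_add _ _ _ _ x i0 i1 (by omega) (by omega) (by omega) (by omega)
      · exact aux_mem_add _ _ _ _ x i1 i1 (by omega) (by omega) (by omega) (by omega)
  have e2 : B - B = Icc (-6 * k) (6 * k) := by
    ext x
    simp only [mem_Icc]
    constructor
    · intro h
      obtain ⟨y, hy, z, hz, e⟩ := Finset.mem_sub.1 h
      rw [mB] at hy hz
      omega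
    · intro h
      by_cases h1 : x < - k
      · exact aux_mem_sub _ _ _ _ x i0 i1 (by omega) (by omega) (by omega) (by omega)
      by_cases h1 : x ≤ k
      · exact aux_mem_sub _ _ _ _ x i1 i1 (by omega) (by omega) (by omega) (by omega)
      · exact aux_mem_sub _ _ _ _ x i1 i0 (by omega) (by omega) (by omega) (by omega)
  rw [e1, e2, card_union_of_disjoint
      (by rw [Finset.disjoint_left]; intro x; simp only [mem_Icc]; omega)]
  simp only [Int.card_Icc]
  omega

theorem aux_pos (k a c T : ℤ) (hk : 1 ≤ k) (hc1 : k ≤ 4 * c) (hc2 : 4 * c ≤ k + 3)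
    (ha : a = 3 * c + 1) (hT : T = 4 * a + k + 1) :
    ∃ A : Finset ℤ, A ⊆ Finset.Icc 0 (3 * T) ∧
      (((A + A) + (A + A)).card : ℤ) - (((A + A) - (A + A)).card : ℤ) = k := by
  set A : Finset ℤ := Icc 0 0 ∪ Icc a (a + c) ∪ Icc T (2 * T) ∪ Icc (3 * T) (3 * T) with hAdef
  have mA : ∀ x, x ∈ A ↔ x = 0 ∨ (a ≤ x ∧ x ≤ a + c) ∨ (T ≤ x ∧ x ≤ 2 * T) ∨ x = 3 * T := by
    intro x; simp only [hAdef, mem_union, mem_Icc]; omega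
  clear_value A
  have mB : ∀ x, x ∈ A + A ↔ x = 0 ∨ (a ≤ x ∧ x ≤ a + c) ∨ (2 * a ≤ x ∧ x ≤ 2 * a + 2 * c) ∨
      (T ≤ x ∧ x ≤ 5 * T) ∨ x = 6 * T := by
    intro x
    constructor
    · intro h
      obtain ⟨y, hy, z, hz, e⟩ := Finset.mem_add.1 h
      rw [mA] at hy hz
      rcases hy with hy | hy | hy | hy <;> rcases hz with hz | hz | hz | hz <;> omega
    · have key : ∀ p q r s : ℤ, p ≤ q → r ≤ s → p + r ≤ x → x ≤ q + s →
          (∀ y, p ≤ y → y ≤ q → y ∈ A) → (∀ y, r ≤ y → y ≤ s → y ∈ A) → x ∈ A + A :=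
        fun p q r s h1 h2 h3 h4 h5 h6 => aux_mem_add p q r s x h5 h6 h1 h2 h3 h4
      have i0 : ∀ y, 0 ≤ y → y ≤ 0 → y ∈ A := fun y _ _ => (mA y).2 (by omega)
      have i1 : ∀ y, a ≤ y → y ≤ a + c → y ∈ A := fun y _ _ => (mA y).2 (by omega)
      have i2 : ∀ y, T ≤ y → y ≤ 2 * T → y ∈ A := fun y _ _ => (mA y).2 (by omega)
      have i3 : ∀ y, 3 * T ≤ y → y ≤ 3 * T → y ∈ A := fun y _ _ => (mA y).2 (by omega)
      rintro (h | h | h | h | h)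
      · exact key _ _ _ _ (by omega) (by omega) (by omega) (by omega) i0 i0
      · exact key _ _ _ _ (by omega) (by omega) (by omega) (by omega) i0 i1
      · exact key _ _ _ _ (by omega) (by omega) (by omega) (by omega) i1 i1
      · by_cases h1 : x ≤ 2 * T
        · exact key _ _ _ _ (by omega) (by omega) (by omega) (by omega) i0 i2
        by_cases h1 : x ≤ 4 * T
        · exact key _ _ _ _ (by omega) (by omega) (by omega) (by omega) i2 i2
        · exact key _ _ _ _ (by omega) (by omega) (by omega) (by omega) i2 i3
      · exact key _ _ _ _ (by omega) (by omega) (by omega) (by omega) i3 i3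
  have hsub : A ⊆ Icc 0 (3 * T) := by
    intro x hx
    rw [mA] at hx; rw [mem_Icc]; omega
  refine ⟨A, hsub, ?_⟩
  generalize A + A = B at mB
  have i0 : ∀ y, 0 ≤ y → y ≤ 0 → y ∈ B := fun y _ _ => (mB y).2 (by omega)
  have i1 : ∀ y, a ≤ y → y ≤ a + c → y ∈ B := fun y _ _ => (mB y).2 (by omega)
  have i2 : ∀ y, 2 * a ≤ y → y ≤ 2 * a + 2 * c → y ∈ B := fun y _ _ => (mB y).2 (by omega)
  have i3 : ∀ y, T ≤ y → y ≤ 5 * T → y ∈ B := fun y _ _ => (mB y).2 (by omega)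
  have i4 : ∀ y, 6 * T ≤ y → y ≤ 6 * T → y ∈ B := fun y _ _ => (mB y).2 (by omega)
  have e1 : B + B = Icc 0 0 ∪ (Icc a (a + c) ∪ (Icc (2 * a) (2 * a + 2 * c) ∪
      (Icc (3 * a) (3 * a + 3 * c) ∪ (Icc (4 * a) (11 * T) ∪ Icc (12 * T) (12 * T))))) := by
    ext x
    simp only [mem_union, mem_Icc]
    constructor
    · intro h
      obtain ⟨y, hy, z, hz, e⟩ := Finset.mem_add.1 h
      rw [mB] at hy hz
      rcases hy with hy | hy | hy | hy | hy <;> rcases hz with hz | hz | hz | hz | hz <;> omega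
    · have key : ∀ p q r s : ℤ, p ≤ q → r ≤ s → p + r ≤ x → x ≤ q + s →
          (∀ y, p ≤ y → y ≤ q → y ∈ B) → (∀ y, r ≤ y → y ≤ s → y ∈ B) → x ∈ B + B :=
        fun p q r s h1 h2 h3 h4 h5 h6 => aux_mem_add p q r s x h5 h6 h1 h2 h3 h4
      rintro (h | h | h | h | h | h)
      · exact key _ _ _ _ (by omega) (by omega) (by omega) (by omega) i0 i0
      · exact key _ _ _ _ (by omega) (by omega) (by omega) (by omega) i0 i1
      · exact key _ _ _ _ (by omega) (by omega) (by omega) (by omega) i0 i2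
      · exact key _ _ _ _ (by omega) (by omega) (by omega) (by omega) i1 i2
      · by_cases h1 : x < T
        · exact key _ _ _ _ (by omega) (by omega) (by omega) (by omega) i2 i2
        by_cases h1 : x ≤ 5 * T
        · exact key _ _ _ _ (by omega) (by omega) (by omega) (by omega) i0 i3
        by_cases h1 : x ≤ 10 * T
        · exact key _ _ _ _ (by omega) (by omega) (by omega) (by omega) i3 i3
        · exact key _ _ _ _ (by omega) (by omega) (by omega) (by omega) i3 i4
      · exact key _ _ _ _ (by omega) (by omega) (by omega) (by omega) i4 i4
  have e2 : B - B = Icc (-6 * T) (-6 * T) ∪ (Icc (-6 * T + a) (-6 * T + a + c) ∪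
      (Icc (-6 * T + 2 * a) (-6 * T + 2 * a + 2 * c) ∪ (Icc (-5 * T) (5 * T) ∪
      (Icc (6 * T - 2 * a - 2 * c) (6 * T - 2 * a) ∪ (Icc (6 * T - a - c) (6 * T - a) ∪
      Icc (6 * T) (6 * T)))))) := by
    ext x
    simp only [mem_union, mem_Icc]
    constructor
    · intro h
      obtain ⟨y, hy, z, hz, e⟩ := Finset.mem_sub.1 h
      rw [mB] at hy hz
      rcases hy with hy | hy | hy | hy | hy <;> rcases hz with hz | hz | hz | hz | hz <;> omega
    · have key : ∀ p q r s : ℤ, p ≤ q → r ≤ s → p - s ≤ x → x ≤ q - r →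
          (∀ y, p ≤ y → y ≤ q → y ∈ B) → (∀ y, r ≤ y → y ≤ s → y ∈ B) → x ∈ B - B :=
        fun p q r s h1 h2 h3 h4 h5 h6 => aux_mem_sub p q r s x h5 h6 h1 h2 h3 h4
      rintro (h | h | h | h | h | h | h)
      · exact key _ _ _ _ (by omega) (by omega) (by omega) (by omega) i0 i4
      · exact key _ _ _ _ (by omega) (by omega) (by omega) (by omega) i1 i4
      · exact key _ _ _ _ (by omega) (by omega) (by omega) (by omega) i2 i4
      · by_cases h1 : x ≤ - T
        · exact key _ _ _ _ (by omega) (by omega) (by omega) (by omega) i0 i3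
        by_cases h1 : x ≤ T
        · exact key _ _ _ _ (by omega) (by omega) (by omega) (by omega) i3 i3
        · exact key _ _ _ _ (by omega) (by omega) (by omega) (by omega) i3 i0
      · exact key _ _ _ _ (by omega) (by omega) (by omega) (by omega) i4 i2
      · exact key _ _ _ _ (by omega) (by omega) (by omega) (by omega) i4 i1
      · exact key _ _ _ _ (by omega) (by omega) (by omega) (by omega) i4 i0
  have c1 : ((B + B).card : ℤ) = 6 * c + k + 10 * T + 7 := by
    rw [e1]
    repeat rw [card_union_of_disjoint
      (by rw [Finset.disjoint_left]; intro x; simp only [mem_union, mem_Icc]; omega)]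
    simp only [Int.card_Icc]
    omega
  have c2 : ((B - B).card : ℤ) = 6 * c + 10 * T + 7 := by
    rw [e2]
    repeat rw [card_union_of_disjoint
      (by rw [Finset.disjoint_left]; intro x; simp only [mem_union, mem_Icc]; omega)]
    simp only [Int.card_Icc]
    omega
  rw [c1, c2]; ring

/-- Miller–Pegado–Robinson: for each nonzero integer `k` there is a set
`A ⊆ {0,…,157|k|}` with `|2A+2A| - |2A-2A| = k` (where `2A = A+A`); moreover, for `|k|`
sufficiently large one may take `A ⊆ {0,…,35|k|}`. -/
theorem two_a_plus_two_a_difference :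
    (∀ k : ℤ, k ≠ 0 → ∃ A : Finset ℤ, A ⊆ Finset.Icc 0 (157 * |k|) ∧
      (((A + A) + (A + A)).card : ℤ) - (((A + A) - (A + A)).card : ℤ) = k) ∧
    ∃ K : ℤ, ∀ k : ℤ, k ≠ 0 → K ≤ |k| → ∃ A : Finset ℤ, A ⊆ Finset.Icc 0 (35 * |k|) ∧
      (((A + A) + (A + A)).card : ℤ) - (((A + A) - (A + A)).card : ℤ) = k := by
  have main : ∀ k : ℤ, k ≠ 0 → ∃ A : Finset ℤ, A ⊆ Finset.Icc 0 (12 * |k| + 42) ∧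
      (((A + A) + (A + A)).card : ℤ) - (((A + A) - (A + A)).card : ℤ) = k := by
    intro k hk
    rcases lt_or_gt_of_ne hk with h | h
    · obtain ⟨A, hA, e⟩ := aux_neg (-k) (by omega)
      refine ⟨A, hA.trans (Icc_subset_Icc le_rfl ?_), by omega⟩
      rw [abs_of_neg h]; omega
    · obtain ⟨A, hA, e⟩ := aux_pos k (3 * ((k + 3) / 4) + 1) ((k + 3) / 4) _ (by omega) (by omega)
        (by omega) rfl rfl
      refine ⟨A, hA.trans (Icc_subset_Icc le_rfl ?_), e⟩
      rw [abs_of_pos h]; omega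
  refine ⟨fun k hk => ?_, 2, fun k hk h2 => ?_⟩
  · obtain ⟨A, hA, e⟩ := main k hk
    have := abs_pos.2 hk
    exact ⟨A, hA.trans (Icc_subset_Icc le_rfl (by omega)), e⟩
  · obtain ⟨A, hA, e⟩ := main k hk
    exact ⟨A, hA.trans (Icc_subset_Icc le_rfl (by omega)), e⟩
end

section
/- Let s₁, d₁, s₂, d₂ be non-negative integers with s₁+d₁ = s₂+d₂ = k ≥ 2 and with {s₁, d₁} ≠ {s₂, d₂} as unordered pairs. Then a positive percentage of sets satisfy |s₁A − d₁A| > |s₂A − d₂A|: the liminf as n → ∞ of (number of subsets A ⊆ {0,1,…,n−1} with |s₁A − d₁A| > |s₂A − d₂A|) divided by 2^n is strictly positive. -/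
open Finset Filter
open scoped Pointwise

/-- The `s`-fold sumset `sA = A + ⋯ + A` (`s` times), with `0A = {0}`. -/
def foldSum : ℕ → Finset ℤ → Finset ℤ
  | 0, _ => {0}
  | s + 1, A => A + foldSum s A

theorem fs_zero (A : Finset ℤ) (x : ℤ) : x ∈ foldSum 0 A ↔ x = 0 := by
  simp [foldSum]

theorem fs_succ (s : ℕ) (A : Finset ℤ) (x : ℤ) :
    x ∈ foldSum (s+1) A ↔ ∃ a ∈ A, ∃ b ∈ foldSum s A, a + b = x := by
  simp [foldSum, Finset.mem_add]

theorem fs_nonneg {A : Finset ℤ} (h : ∀ x ∈ A, 0 ≤ x) (s : ℕ) :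
    ∀ x ∈ foldSum s A, 0 ≤ x := by
  induction s with
  | zero => intro x hx; rw [fs_zero] at hx; omega
  | succ s ih =>
    intro x hx
    obtain ⟨a, ha, b, hb, rfl⟩ := (fs_succ _ _ _).1 hx
    have := h a ha
    have := ih b hb
    omega

theorem fs_refl {A A' : Finset ℤ} {N : ℤ} (h : ∀ x, x ∈ A' ↔ N - x ∈ A) (s : ℕ) :
    ∀ x, x ∈ foldSum s A' ↔ s * N - x ∈ foldSum s A := by
  induction s with
  | zero => intro x; rw [fs_zero, fs_zero]; push_cast; constructor <;> intro h <;> linarith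
  | succ s ih =>
    intro x
    rw [fs_succ, fs_succ]
    constructor
    · rintro ⟨a, ha, b, hb, rfl⟩
      exact ⟨N - a, (h a).1 ha, s * N - b, (ih b).1 hb, by push_cast; ring⟩
    · rintro ⟨a, ha, b, hb, e⟩
      refine ⟨N - a, (h _).2 (by simpa using ha), s * N - b, (ih _).2 (by simpa using hb), ?_⟩
      push_cast at e
      linarith

theorem fs_window {A L : Finset ℤ} {V : ℤ} (hA : ∀ x ∈ A, 0 ≤ x) (hL : ∀ x ∈ L, 0 ≤ x)
    (h : ∀ x, x < V → (x ∈ A ↔ x ∈ L)) (s : ℕ) :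
    ∀ x, x < V → (x ∈ foldSum s A ↔ x ∈ foldSum s L) := by
  induction s with
  | zero => intro x _; rw [fs_zero, fs_zero]
  | succ s ih =>
    intro x hx
    rw [fs_succ, fs_succ]
    constructor
    · rintro ⟨a, ha, b, hb, rfl⟩
      have := hA a ha
      have := fs_nonneg hA s b hb
      exact ⟨a, (h a (by omega)).1 ha, b, (ih b (by omega)).1 hb, rfl⟩
    · rintro ⟨a, ha, b, hb, rfl⟩
      have := hL a ha
      have := fs_nonneg hL s b hb
      exact ⟨a, (h a (by omega)).2 ha, b, (ih b (by omega)).2 hb, rfl⟩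

structure GG (V N : ℤ) (L R A A' : Finset ℤ) : Prop where
  rf : ∀ x, x ∈ A' ↔ N - x ∈ A
  nn : ∀ x ∈ A, 0 ≤ x
  nn' : ∀ x ∈ A', 0 ≤ x
  Ln : ∀ x ∈ L, 0 ≤ x
  Rn : ∀ x ∈ R, 0 ≤ x
  hL : ∀ x, x < V → (x ∈ A ↔ x ∈ L)
  hR : ∀ x, x < V → (x ∈ A' ↔ x ∈ R)
  z : 0 ∈ A
  z' : 0 ∈ A'
  ss : ∀ y, V ≤ y → y ≤ 2 * N - V → ∃ a ∈ A, ∃ b ∈ A, a + b = y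
  ss' : ∀ y, V ≤ y → y ≤ 2 * N - V → ∃ a ∈ A', ∃ b ∈ A', a + b = y
  dd : ∀ y, V ≤ y → y ≤ 2 * N - V → ∃ a ∈ A, ∃ b ∈ A', a + b = y
  hV : 0 < V
  hN : 2 * V ≤ N

theorem GG.swap {V N : ℤ} {L R A A' : Finset ℤ} (h : GG V N L R A A') : GG V N R L A' A where
  rf := fun x => by rw [h.rf]; simp
  nn := h.nn'
  nn' := h.nn
  Ln := h.Rn
  Rn := h.Ln
  hL := h.hR
  hR := h.hL
  z := h.z'
  z' := h.z
  ss := h.ss'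
  ss' := h.ss
  dd := fun y h1 h2 => by
    obtain ⟨a, ha, b, hb, e⟩ := h.dd y h1 h2
    exact ⟨b, hb, a, ha, by omega⟩
  hV := h.hV
  hN := h.hN

theorem GG.mid {V N : ℤ} {L R A A' : Finset ℤ} (h : GG V N L R A A') (t : ℕ) :
    ∀ s d : ℕ, s + d = t + 2 → ∀ y : ℤ, V ≤ y → y ≤ (t + 2) * N - V →
      y ∈ foldSum s A + foldSum d A' := by
  have hV := h.hV
  have hN := h.hN
  have hNA : N ∈ A := by have := (h.rf 0).1 h.z'; simpa using this
  have hNA' : N ∈ A' := (h.rf N).2 (by simpa using h.z)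
  induction t with
  | zero =>
    intro s d hsd y h1 h2
    push_cast at h2
    have h2' : y ≤ 2 * N - V := by linarith
    rw [Finset.mem_add]
    obtain ⟨rfl, rfl⟩ | ⟨rfl, rfl⟩ | ⟨rfl, rfl⟩ : (s = 0 ∧ d = 2) ∨ (s = 1 ∧ d = 1) ∨ (s = 2 ∧ d = 0) := by
      omega
    · obtain ⟨a, ha, b, hb, e⟩ := h.ss' y h1 h2'
      exact ⟨0, by simp [foldSum], y, by simp [foldSum, Finset.mem_add]; exact ⟨a, ha, b, hb, e⟩, by simp⟩
    · obtain ⟨a, ha, b, hb, e⟩ := h.dd y h1 h2'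
      exact ⟨a, by simpa [foldSum, Finset.mem_add] using ha, b, by simpa [foldSum, Finset.mem_add] using hb, e⟩
    · obtain ⟨a, ha, b, hb, e⟩ := h.ss y h1 h2'
      exact ⟨y, by simp [foldSum, Finset.mem_add]; exact ⟨a, ha, b, hb, e⟩, 0, by simp [foldSum], by simp⟩
  | succ t ih =>
    intro s d hsd y h1 h2
    have hpos : 0 ≤ (t:ℤ) * N := mul_nonneg (by positivity) (by omega)
    push_cast at h2
    have key : ∃ c : ℤ, (c = 0 ∨ c = N) ∧ V ≤ y - c ∧ y - c ≤ (t + 2) * N - V := by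
      by_cases hy : y ≤ (t + 2) * N - V
      · exact ⟨0, Or.inl rfl, by omega, by omega⟩
      · refine ⟨N, Or.inr rfl, ?_, ?_⟩ <;> nlinarith
    obtain ⟨c, hc, h3, h4⟩ := key
    have hcA : c ∈ A := by rcases hc with rfl | rfl; exacts [h.z, hNA]
    have hcA' : c ∈ A' := by rcases hc with rfl | rfl; exacts [h.z', hNA']
    rcases s with _ | s
    · rcases d with _ | d
      · omega
      have := ih 0 d (by omega) (y - c) h3 h4
      rw [Finset.mem_add] at this ⊢
      obtain ⟨p, hp, q, hq, e⟩ := this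
      exact ⟨p, hp, c + q, (fs_succ _ _ _).2 ⟨c, hcA', q, hq, rfl⟩, by omega⟩
    · have := ih s d (by omega) (y - c) h3 h4
      rw [Finset.mem_add] at this ⊢
      obtain ⟨p, hp, q, hq, e⟩ := this
      exact ⟨c + p, (fs_succ _ _ _).2 ⟨c, hcA, p, hp, rfl⟩, q, hq, by omega⟩

/-- window count -/
def cw (V : ℤ) (L R : Finset ℤ) (s d : ℕ) : ℕ := ((foldSum s L + foldSum d R).filter (· < V)).card

theorem GG.low {V N : ℤ} {L R A A' : Finset ℤ} (h : GG V N L R A A') (s d : ℕ) (y : ℤ) (hy : y < V) :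
    y ∈ foldSum s A + foldSum d A' ↔ y ∈ foldSum s L + foldSum d R := by
  rw [Finset.mem_add, Finset.mem_add]
  constructor
  · rintro ⟨a, ha, b, hb, rfl⟩
    have := fs_nonneg h.nn s a ha
    have := fs_nonneg h.nn' d b hb
    exact ⟨a, (fs_window h.nn h.Ln h.hL s a (by omega)).1 ha, b,
      (fs_window h.nn' h.Rn h.hR d b (by omega)).1 hb, rfl⟩
  · rintro ⟨a, ha, b, hb, rfl⟩
    have := fs_nonneg h.Ln s a ha
    have := fs_nonneg h.Rn d b hb
    exact ⟨a, (fs_window h.nn h.Ln h.hL s a (by omega)).2 ha, b,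
      (fs_window h.nn' h.Rn h.hR d b (by omega)).2 hb, rfl⟩

theorem GG.rfl2 {V N : ℤ} {L R A A' : Finset ℤ} (h : GG V N L R A A') (s d : ℕ) (y : ℤ) :
    y ∈ foldSum s A + foldSum d A' ↔ (s + d : ℤ) * N - y ∈ foldSum s A' + foldSum d A := by
  have e1 := fs_refl h.rf
  have e2 := fs_refl h.swap.rf
  rw [Finset.mem_add, Finset.mem_add]
  constructor
  · rintro ⟨a, ha, b, hb, rfl⟩
    exact ⟨_, (e2 s a).1 ha, _, (e1 d b).1 hb, by ring⟩
  · rintro ⟨a, ha, b, hb, e⟩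
    exact ⟨_, (e1 s a).1 ha, _, (e2 d b).1 hb, by linarith⟩

theorem GG.card {V N : ℤ} {L R A A' : Finset ℤ} (h : GG V N L R A A') (s d t : ℕ)
    (hsd : s + d = t + 2) :
    (foldSum s A - foldSum d A).card =
      (Icc V ((t + 2) * N - V)).card + cw V L R s d + cw V R L s d := by
  have hV := h.hV
  have hN := h.hN
  have hsd' : (s : ℤ) + d = t + 2 := by exact_mod_cast hsd
  have hpos : 0 ≤ (t:ℤ) * N := mul_nonneg (by positivity) (by omega)
  have e0 : (foldSum s A - foldSum d A).card = (foldSum s A + foldSum d A').card := by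
    apply Finset.card_bij' (fun x _ => x + d * N) (fun x _ => x - d * N)
    · intro x hx
      obtain ⟨a, ha, b, hb, rfl⟩ := Finset.mem_sub.1 hx
      exact Finset.mem_add.2 ⟨a, ha, _, (fs_refl h.swap.rf d b).1 hb, by ring⟩
    · intro x hx
      obtain ⟨a, ha, b, hb, rfl⟩ := Finset.mem_add.1 hx
      exact Finset.mem_sub.2 ⟨a, ha, _, (fs_refl h.rf d b).1 hb, by ring⟩
    · intro x _; ring
    · intro x _; ring
  rw [e0]
  have e1 : foldSum s A + foldSum d A' = (Icc V ((t + 2) * N - V) ∪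
      (foldSum s L + foldSum d R).filter (· < V)) ∪
      ((foldSum s R + foldSum d L).filter (· < V)).image (fun x => (t + 2) * N - x) := by
    ext y
    simp only [Finset.mem_union, Finset.mem_Icc, Finset.mem_filter, Finset.mem_image]
    constructor
    · intro hy
      by_cases h1 : y < V
      · exact Or.inl (Or.inr ⟨(h.low s d y h1).1 hy, h1⟩)
      by_cases h2 : y ≤ (t + 2) * N - V
      · exact Or.inl (Or.inl ⟨by omega, h2⟩)
      right
      have := (h.rfl2 s d y).1 hy
      rw [hsd'] at this
      exact ⟨_, ⟨(h.swap.low s d _ (by linarith)).1 this, by linarith⟩, by ring⟩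
    · rintro ((⟨h1, h2⟩ | ⟨h1, h2⟩) | ⟨x, ⟨h1, h2⟩, rfl⟩)
      · exact h.mid t s d hsd y h1 h2
      · exact (h.low s d y h2).2 h1
      · rw [h.rfl2 s d, hsd']
        have := (h.swap.low s d x h2).2 h1
        simpa using this
  rw [e1, Finset.card_union_of_disjoint, Finset.card_union_of_disjoint, Finset.card_image_of_injective]
  · rfl
  · intro x y hxy; simp only at hxy; linarith
  · rw [Finset.disjoint_left]
    intro x hx hx'
    simp only [Finset.mem_Icc, Finset.mem_filter] at hx hx'
    omega
  · rw [Finset.disjoint_left]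
    intro x hx hx'
    simp only [Finset.mem_union, Finset.mem_Icc, Finset.mem_filter, Finset.mem_image] at hx hx'
    obtain ⟨y, ⟨_, hy⟩, rfl⟩ := hx'
    rcases hx with ⟨_, hx⟩ | ⟨_, hx⟩
    · linarith
    · nlinarith

theorem fs_pair (c : ℤ) (s : ℕ) : ∀ x, x ∈ foldSum s {0, c} ↔ ∃ i : ℕ, i ≤ s ∧ x = i * c := by
  induction s with
  | zero => intro x; rw [fs_zero]; simp
  | succ s ih =>
    intro x
    rw [fs_succ]
    constructor
    · rintro ⟨a, ha, b, hb, rfl⟩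
      obtain ⟨i, hi, rfl⟩ := (ih b).1 hb
      simp only [Finset.mem_insert, Finset.mem_singleton] at ha
      rcases ha with rfl | rfl
      · exact ⟨i, by omega, by ring⟩
      · exact ⟨i + 1, by omega, by push_cast; ring⟩
    · rintro ⟨i, hi, rfl⟩
      rcases i with _ | i
      · exact ⟨0, by simp, 0, (ih 0).2 ⟨0, by omega, by simp⟩, by simp⟩
      · exact ⟨c, by simp, i * c, (ih _).2 ⟨i, by omega, rfl⟩, by push_cast; ring⟩

theorem fs_sing (s : ℕ) : foldSum s {0} = {0} := by
  induction s with
  | zero => rfl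
  | succ s ih => simp [foldSum, ih]

theorem fs_triple (c : ℤ) (s : ℕ) : ∀ x, x ∈ foldSum s {0, 1, c} ↔
    ∃ i j : ℕ, i + j ≤ s ∧ x = i + j * c := by
  induction s with
  | zero => intro x; rw [fs_zero]; simp
  | succ s ih =>
    intro x
    rw [fs_succ]
    constructor
    · rintro ⟨a, ha, b, hb, rfl⟩
      obtain ⟨i, j, hi, rfl⟩ := (ih b).1 hb
      simp only [Finset.mem_insert, Finset.mem_singleton] at ha
      rcases ha with rfl | rfl | rfl
      · exact ⟨i, j, by omega, by ring⟩
      · exact ⟨i + 1, j, by omega, by push_cast; ring⟩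
      · exact ⟨i, j + 1, by omega, by push_cast; ring⟩
    · rintro ⟨i, j, hi, rfl⟩
      rcases i with _ | i
      · rcases j with _ | j
        · exact ⟨0, by simp, 0, (ih 0).2 ⟨0, 0, by omega, by simp⟩, by simp⟩
        · exact ⟨c, by simp, j * c, (ih _).2 ⟨0, j, by omega, by simp⟩, by push_cast; ring⟩
      · exact ⟨1, by simp, i + j * c, (ih _).2 ⟨i, j, by omega, rfl⟩, by push_cast; ring⟩

theorem enc_inj (k i j i' j' : ℕ) (h1 : i ≤ k) (h2 : i' ≤ k)
    (h : (i : ℤ) + j * (k + 1 : ℤ) = i' + j' * (k + 1 : ℤ)) : i = i' ∧ j = j' := by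
  have h' : i + (k + 1) * j = i' + (k + 1) * j' := by
    have : (i : ℤ) + (k + 1) * j = i' + (k + 1) * j' := by linarith
    exact_mod_cast this
  have a1 := congrArg (· % (k + 1)) h'
  simp only [Nat.add_mul_mod_self_left] at a1
  rw [Nat.mod_eq_of_lt (by omega), Nat.mod_eq_of_lt (by omega)] at a1
  subst a1
  refine ⟨rfl, ?_⟩
  have := Nat.add_left_cancel h'
  exact Nat.eq_of_mul_eq_mul_left (by omega) this

theorem cw_pair (k s d : ℕ) (h : s + d = k) (V : ℤ) (hV : V = (k + 2) * (k + 2)) :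
    cw V {0, 1} {0, (k + 1 : ℤ)} s d = (s + 1) * (d + 1) := by
  have e : ((foldSum s {0, 1} + foldSum d {0, (k + 1 : ℤ)}).filter (· < V)) =
      (range (s + 1) ×ˢ range (d + 1)).image (fun p => (p.1 : ℤ) + p.2 * (k + 1 : ℤ)) := by
    ext x
    simp only [Finset.mem_filter, Finset.mem_add, Finset.mem_image, Finset.mem_product,
      Finset.mem_range, fs_pair, Prod.exists]
    constructor
    · rintro ⟨⟨_, ⟨i, hi, rfl⟩, _, ⟨j, hj, rfl⟩, rfl⟩, _⟩
      exact ⟨i, j, ⟨by omega, by omega⟩, by ring⟩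
    · rintro ⟨i, j, ⟨hi, hj⟩, rfl⟩
      refine ⟨⟨_, ⟨i, by omega, rfl⟩, _, ⟨j, by omega, rfl⟩, by ring⟩, ?_⟩
      have h1 : (i : ℤ) ≤ k := by omega
      have h2 : (j : ℤ) ≤ k := by omega
      nlinarith
  rw [cw, e, Finset.card_image_of_injOn, Finset.card_product, Finset.card_range, Finset.card_range]
  rintro ⟨i, j⟩ hp ⟨i', j'⟩ hp' he
  simp only [Finset.coe_product, Set.mem_prod, Finset.mem_coe, Finset.mem_range] at hp hp'
  obtain ⟨rfl, rfl⟩ := enc_inj k i j i' j' (by omega) (by omega) he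
  rfl

theorem cw_swap (V : ℤ) (L R : Finset ℤ) (s d : ℕ) : cw V L R s d = cw V R L d s := by
  rw [cw, cw, add_comm]

theorem cw_triple (k s d : ℕ) (h : s + d = k) (V : ℤ) (hV : V = (k + 2) * (k + 2)) :
    2 * cw V {0, 1, (k + 1 : ℤ)} {0} s d = (s + 1) * (s + 2) := by
  have e : ((foldSum s {0, 1, (k + 1 : ℤ)} + foldSum d {0}).filter (· < V)) =
      ((range (s + 1)).sigma (fun i => range (i + 1))).image
        (fun p => ((p.1 - p.2 : ℕ) : ℤ) + p.2 * (k + 1 : ℤ)) := by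
    ext x
    simp only [Finset.mem_filter, Finset.mem_add, Finset.mem_image, Finset.mem_sigma,
      Finset.mem_range, fs_triple, fs_sing, Finset.mem_singleton, Sigma.exists]
    constructor
    · rintro ⟨⟨_, ⟨i, j, hi, rfl⟩, _, rfl, rfl⟩, _⟩
      exact ⟨i + j, j, ⟨by omega, by omega⟩, by simp⟩
    · rintro ⟨i, j, ⟨hi, hj⟩, rfl⟩
      refine ⟨⟨_, ⟨i - j, j, by omega, rfl⟩, _, rfl, by ring⟩, ?_⟩
      have h1 : ((i - j : ℕ) : ℤ) ≤ k := by omega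
      have h2 : (j : ℤ) ≤ k := by omega
      nlinarith
  rw [cw, e, Finset.card_image_of_injOn, Finset.card_sigma]
  · simp only [Finset.card_range]
    clear e h
    induction s with
    | zero => simp
    | succ s ih => rw [Finset.sum_range_succ, mul_add, ih]; ring
  · rintro ⟨i, j⟩ hp ⟨i', j'⟩ hp' he
    simp only [Finset.coe_sigma, Set.mem_sigma_iff, Finset.mem_coe, Finset.mem_range] at hp hp'
    obtain ⟨h1, h2⟩ := enc_inj k (i - j) j (i' - j') j' (by omega) (by omega) he
    have : i = i' := by omega
    subst this; subst h2
    rfl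

theorem choose_LR (s₁ d₁ s₂ d₂ k : ℕ) (h₁ : s₁ + d₁ = k) (h₂ : s₂ + d₂ = k)
    (hne : ¬((s₁ = s₂ ∧ d₁ = d₂) ∨ (s₁ = d₂ ∧ d₁ = s₂))) :
    ∃ (V : ℕ) (L R : Finset ℤ), 0 < V ∧ (∀ x ∈ L, 0 ≤ x ∧ x < V) ∧ (∀ x ∈ R, 0 ≤ x ∧ x < V) ∧
      0 ∈ L ∧ 0 ∈ R ∧ cw V L R s₂ d₂ + cw V R L s₂ d₂ < cw V L R s₁ d₁ + cw V R L s₁ d₁ := by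
  have hb : ∀ x : ℤ, x = 0 ∨ x = 1 ∨ x = k + 1 → 0 ≤ x ∧ x < ((k + 2) * (k + 2) : ℕ) := by
    intro x hx
    push_cast
    constructor
    · omega
    · have : x ≤ k + 1 := by omega
      nlinarith
  have hv : (((k + 2) * (k + 2) : ℕ) : ℤ) = (k + 2) * (k + 2) := by push_cast; ring
  have hs : s₁ * d₁ ≠ s₂ * d₂ := by
    intro h
    apply hne
    have hd1 : (d₁ : ℤ) = k - s₁ := by omega
    have hd2 : (d₂ : ℤ) = k - s₂ := by omega
    have hz : (s₁ : ℤ) * d₁ = s₂ * d₂ := by exact_mod_cast h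
    rw [hd1, hd2] at hz
    have : ((s₁ : ℤ) - s₂) * (k - s₁ - s₂) = 0 := by linarith
    rcases mul_eq_zero.1 this with h | h <;> omega
  rcases lt_or_gt_of_ne hs with h | h
  · refine ⟨(k + 2) * (k + 2), {0, 1, (k + 1 : ℤ)}, {0}, by positivity, ?_, ?_, by simp, by simp, ?_⟩
    · intro x hx; apply hb; simpa using hx
    · intro x hx; apply hb; left; simpa using hx
    · rw [cw_swap _ {0}, cw_swap _ {0}]
      have a1 := cw_triple k s₁ d₁ h₁ _ hv
      have a2 := cw_triple k s₂ d₂ h₂ _ hv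
      have a3 := cw_triple k d₁ s₁ (by omega) _ hv
      have a4 := cw_triple k d₂ s₂ (by omega) _ hv
      have e1 : k * k = (s₁ + d₁) * (s₁ + d₁) := by rw [h₁]
      have e2 : k * k = (s₂ + d₂) * (s₂ + d₂) := by rw [h₂]
      nlinarith
  · refine ⟨(k + 2) * (k + 2), {0, 1}, {0, (k + 1 : ℤ)}, by positivity, ?_, ?_, by simp, by simp, ?_⟩
    · intro x hx; apply hb; simp at hx; tauto
    · intro x hx; apply hb; simp at hx; tauto
    · rw [cw_swap _ {0, (k + 1 : ℤ)}, cw_swap _ {0, (k + 1 : ℤ)}]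
      rw [cw_pair k s₁ d₁ h₁ _ hv, cw_pair k s₂ d₂ h₂ _ hv, cw_pair k d₁ s₁ (by omega) _ hv,
        cw_pair k d₂ s₂ (by omega) _ hv]
      nlinarith

theorem bad_count (f : ℤ → ℤ) (P : Finset ℤ) : ∀ U : Finset ℤ, P ⊆ U →
    (∀ p ∈ P, f p ∈ U ∧ f p ∉ P) → (∀ p ∈ P, ∀ q ∈ P, f p = f q → p = q) →
    4 ^ P.card * (U.powerset.filter (fun B => ∀ p ∈ P, ¬(p ∈ B ∧ f p ∈ B))).card
      ≤ 3 ^ P.card * 2 ^ U.card := by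
  induction P using Finset.induction_on with
  | empty => intro U _ _ _; simp
  | insert p P hp ih =>
    intro U hPU hf hinj
    have hpU : p ∈ U := hPU (by simp)
    obtain ⟨hfU, hfP⟩ := hf p (by simp)
    rw [Finset.mem_insert, not_or] at hfP
    have key := ih (U \ {p, f p}) (by
      intro q hq
      rw [Finset.mem_sdiff]
      refine ⟨hPU (by simp [hq]), ?_⟩
      simp only [Finset.mem_insert, Finset.mem_singleton, not_or]
      constructor
      · rintro rfl; exact hp hq
      · rintro rfl; exact hfP.2 hq) (by
      intro q hq
      obtain ⟨h1, h2⟩ := hf q (by simp [hq])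
      rw [Finset.mem_insert, not_or] at h2
      refine ⟨?_, h2.2⟩
      rw [Finset.mem_sdiff]
      refine ⟨h1, ?_⟩
      simp only [Finset.mem_insert, Finset.mem_singleton, not_or]
      refine ⟨h2.1, ?_⟩
      intro h
      have := hinj q (by simp [hq]) p (by simp) h
      subst this; exact hp hq) (by
      intro a ha b hb h
      exact hinj a (by simp [ha]) b (by simp [hb]) h)
    have hcU : (U \ {p, f p}).card + 2 = U.card := by
      have h2 : ({p, f p} : Finset ℤ).card = 2 := Finset.card_pair (fun h => hfP.1 h.symm)
      have := Finset.card_sdiff_add_card_eq_card (s := {p, f p}) (t := U) (by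
        intro x hx
        simp only [Finset.mem_insert, Finset.mem_singleton] at hx
        rcases hx with rfl | rfl <;> assumption)
      omega
    have hsub : (U.powerset.filter (fun B => ∀ q ∈ insert p P, ¬(q ∈ B ∧ f q ∈ B))) ⊆
        ((((U \ {p, f p}).powerset.filter (fun B => ∀ q ∈ P, ¬(q ∈ B ∧ f q ∈ B)))) ×ˢ
          ({∅, {p}, {f p}} : Finset (Finset ℤ))).image (fun c => c.1 ∪ c.2) := by
      intro B hB
      simp only [Finset.mem_filter, Finset.mem_powerset] at hB
      obtain ⟨hBU, hB⟩ := hB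
      rw [Finset.mem_image]
      refine ⟨(B \ {p, f p}, B ∩ {p, f p}), ?_, ?_⟩
      · simp only [Finset.mem_product, Finset.mem_filter, Finset.mem_powerset]
        refine ⟨⟨Finset.sdiff_subset_sdiff hBU (Finset.Subset.refl _), ?_⟩, ?_⟩
        · intro q hq h
          exact hB q (by simp [hq]) ⟨(Finset.mem_sdiff.1 h.1).1, (Finset.mem_sdiff.1 h.2).1⟩
        · have := hB p (by simp)
          simp only [Finset.mem_insert, Finset.mem_singleton]
          by_cases h1 : p ∈ B
          · have h2 : f p ∉ B := fun h => this ⟨h1, h⟩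
            right; left
            ext x
            simp only [Finset.mem_inter, Finset.mem_insert, Finset.mem_singleton]
            constructor
            · rintro ⟨h, rfl | rfl⟩
              · rfl
              · exact absurd h h2
            · rintro rfl; exact ⟨h1, Or.inl rfl⟩
          · by_cases h2 : f p ∈ B
            · right; right
              ext x
              simp only [Finset.mem_inter, Finset.mem_insert, Finset.mem_singleton]
              constructor
              · rintro ⟨h, rfl | rfl⟩
                · exact absurd h h1
                · rfl
              · rintro rfl; exact ⟨h2, Or.inr rfl⟩
            · left
              ext x
              simp only [Finset.mem_inter, Finset.mem_insert, Finset.mem_singleton]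
              constructor
              · rintro ⟨h, rfl | rfl⟩
                · exact absurd h h1
                · exact absurd h h2
              · intro h; simp at h
      · exact Finset.sdiff_union_inter _ _
    have hc := (Finset.card_le_card hsub).trans Finset.card_image_le
    rw [Finset.card_product] at hc
    have h3 : ({∅, {p}, {f p}} : Finset (Finset ℤ)).card ≤ 3 := Finset.card_le_three
    have hc' := hc.trans (Nat.mul_le_mul_left _ h3)
    rw [Finset.card_insert_of_notMem hp, ← hcU]
    calc _ ≤ 4 ^ (P.card + 1) * (_ * 3) := Nat.mul_le_mul_left _ hc'
      _ = 4 * 3 * (4 ^ P.card * _) := by rw [pow_succ]; ring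
      _ ≤ 4 * 3 * (3 ^ P.card * 2 ^ (U \ {p, f p}).card) := Nat.mul_le_mul_left _ key
      _ = _ := by rw [pow_succ, pow_add]; ring

theorem bad_real (f : ℤ → ℤ) (P U : Finset ℤ) (m : ℕ) (hPU : P ⊆ U)
    (hf : ∀ p ∈ P, f p ∈ U ∧ f p ∉ P) (hinj : ∀ p ∈ P, ∀ q ∈ P, f p = f q → p = q)
    (hm : m ≤ 2 * P.card) (Q : Finset ℤ → Prop) [DecidablePred Q]
    (hQ : ∀ B, Q B → ∀ p ∈ P, ¬(p ∈ B ∧ f p ∈ B)) :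
    ((U.powerset.filter Q).card : ℝ) ≤ (9 / 10) ^ m * 2 ^ U.card := by
  have h0 := bad_count f P U hPU hf hinj
  have h1 : (U.powerset.filter Q).card ≤
      (U.powerset.filter (fun B => ∀ p ∈ P, ¬(p ∈ B ∧ f p ∈ B))).card := by
    apply Finset.card_le_card
    intro B hB
    rw [Finset.mem_filter] at hB ⊢
    exact ⟨hB.1, hQ B hB.2⟩
  have h2 : 4 ^ P.card * (U.powerset.filter Q).card ≤ 3 ^ P.card * 2 ^ U.card :=
    (Nat.mul_le_mul_left _ h1).trans h0
  have h3 : (4 : ℝ) ^ P.card * (U.powerset.filter Q).card ≤ 3 ^ P.card * 2 ^ U.card := by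
    exact_mod_cast h2
  have h4 : ((U.powerset.filter Q).card : ℝ) ≤ (3 / 4) ^ P.card * 2 ^ U.card := by
    rw [div_pow, div_mul_eq_mul_div, le_div_iff₀ (by positivity)]
    linarith
  refine h4.trans ?_
  gcongr
  calc ((3 : ℝ) / 4) ^ P.card ≤ ((9 / 10) ^ 2) ^ P.card := by
        apply pow_le_pow_left₀ <;> norm_num
    _ = (9 / 10) ^ (2 * P.card) := by rw [pow_mul]
    _ ≤ (9 / 10) ^ m := pow_le_pow_of_le_one (by norm_num) (by norm_num) hm

/-- three bad events at level `y`. -/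
def E1 (y : ℤ) (B : Finset ℤ) : Prop := ¬ ∃ a ∈ B, ∃ b ∈ B, a + b = y
def E3 (z : ℤ) (B : Finset ℤ) : Prop := ¬ ∃ a ∈ B, ∃ b ∈ B, a - b = z

open Classical in
theorem bound1 (V N y : ℤ) (m : ℕ) (hm : (m : ℤ) = y - 2 * V) (hy : y ≤ N) (hV : 0 ≤ V) :
    (((Icc V (N - V)).powerset.filter (E1 y)).card : ℝ) ≤ (9 / 10) ^ m * 2 ^ (Icc V (N - V)).card := by
  apply bad_real (fun b => y - b) (Ico V ((y + 1) / 2))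
  · intro x hx
    simp only [Finset.mem_Ico, Finset.mem_Icc] at *
    omega
  · intro p hp
    simp only [Finset.mem_Ico, Finset.mem_Icc] at *
    omega
  · intro p _ q _ h
    omega
  · rw [Int.card_Ico]; omega
  · intro B hB p _ h
    exact hB ⟨p, h.1, _, h.2, by ring⟩

open Classical in
theorem bound2 (V N y : ℤ) (m : ℕ) (hm : (m : ℤ) = y - 2 * V) (hy : y ≤ N) (hV : 0 ≤ V) :
    (((Icc V (N - V)).powerset.filter (E1 (2 * N - y))).card : ℝ)
      ≤ (9 / 10) ^ m * 2 ^ (Icc V (N - V)).card := by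
  apply bad_real (fun b => 2 * N - y - b) (Ioc (N - (y + 1) / 2) (N - V))
  · intro x hx
    simp only [Finset.mem_Ioc, Finset.mem_Icc] at *
    omega
  · intro p hp
    simp only [Finset.mem_Ioc, Finset.mem_Icc] at *
    omega
  · intro p _ q _ h
    omega
  · rw [Int.card_Ioc]; omega
  · intro B hB p _ h
    exact hB ⟨p, h.1, _, h.2, by ring⟩

open Classical in
theorem bound3 (V N y : ℤ) (m : ℕ) (hm : (m : ℤ) = y - 2 * V) (hy : y < N) (hV : 0 ≤ V) :
    (((Icc V (N - V)).powerset.filter (E3 (N - y))).card : ℝ)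
      ≤ (9 / 10) ^ m * 2 ^ (Icc V (N - V)).card := by
  have hz : 0 < N - y := by omega
  have hq : ∀ b : ℤ, (b + (N - y) - V) / (N - y) = (b - V) / (N - y) + 1 := by
    intro b
    rw [show b + (N - y) - V = (b - V) + 1 * (N - y) by ring, Int.add_mul_ediv_right _ _ hz.ne']
  apply bad_real (fun b => b + (N - y)) ((Icc V (y - V)).filter (fun b => ((b - V) / (N - y)) % 2 = 0))
  · intro x hx
    simp only [Finset.mem_filter, Finset.mem_Icc] at *
    omega
  · intro p hp
    simp only [Finset.mem_filter, Finset.mem_Icc] at *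
    refine ⟨by omega, ?_⟩
    rw [hq]
    omega
  · intro p _ q _ h
    omega
  · have h1 := Finset.card_filter_add_card_filter_not (s := Icc V (y - V))
      (fun b => ((b - V) / (N - y)) % 2 = 0)
    rw [Int.card_Icc] at h1
    have h2 : ((Icc V (y - V)).filter (fun b => ¬ ((b - V) / (N - y)) % 2 = 0)).card ≤
        ((Icc V (y - V)).filter (fun b => ((b - V) / (N - y)) % 2 = 0)).card := by
      apply Finset.card_le_card_of_injOn (fun b => b - (N - y))
      · intro b hb
        simp only [Finset.coe_filter, Finset.mem_Icc, Set.mem_ofPred_eq] at *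
        have h3 := hq (b - (N - y))
        rw [sub_add_cancel] at h3
        have h4 : 0 ≤ (b - V) / (N - y) := Int.ediv_nonneg (by omega) hz.le
        have h5 : ((b - V) / (N - y)) * (N - y) ≤ b - V := Int.ediv_mul_le _ hz.ne'
        have h6 : 1 ≤ (b - V) / (N - y) := by omega
        have h7 : N - y ≤ b - V := by nlinarith
        refine ⟨⟨by omega, by omega⟩, by omega⟩
      · intro a _ b _ h
        simp only at h
        omega
    omega
  · intro B hB p _ h
    exact hB ⟨_, h.2, _, h.1, by ring⟩

/-- good middle -/
def MidGood (W N : ℤ) (B : Finset ℤ) : Prop :=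
  ∀ y, W ≤ y → y ≤ N → ¬ E1 y B ∧ ¬ E1 (2 * N - y) B ∧ (y < N → ¬ E3 (N - y) B)

open Classical in
theorem many_good (V N : ℕ) (hN : 2 * V + 50 ≤ N) :
    (2 : ℝ) ^ (Icc (V : ℤ) (N - V)).card ≤
      2 * (((Icc (V : ℤ) (N - V)).powerset.filter (MidGood (2 * V + 50) N)).card : ℝ) := by
  set U := Icc (V : ℤ) (N - V) with hU
  have hcov : U.powerset ⊆ U.powerset.filter (MidGood (2 * V + 50) N) ∪
      (range (N - 2 * V - 50 + 1)).biUnion (fun i =>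
        U.powerset.filter (E1 (2 * V + 50 + i)) ∪ (U.powerset.filter (E1 (2 * N - (2 * V + 50 + i))) ∪
        if (2 * V + 50 + i : ℤ) < N then U.powerset.filter (E3 (N - (2 * V + 50 + i))) else ∅)) := by
    intro B hB
    by_cases hg : MidGood (2 * V + 50) N B
    · exact Finset.mem_union_left _ (Finset.mem_filter.2 ⟨hB, hg⟩)
    · apply Finset.mem_union_right
      rw [Finset.mem_biUnion]
      unfold MidGood at hg
      push Not at hg
      obtain ⟨y, h1, h2, h3⟩ := hg
      obtain ⟨i, hi⟩ : ∃ i : ℕ, y = 2 * V + 50 + i := ⟨(y - (2 * V + 50)).toNat, by omega⟩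
      subst hi
      refine ⟨i, by rw [Finset.mem_range]; omega, ?_⟩
      simp only [Finset.mem_union, Finset.mem_filter]
      by_cases a1 : E1 (2 * V + 50 + i) B
      · exact Or.inl ⟨hB, a1⟩
      by_cases a2 : E1 (2 * N - (2 * V + 50 + i)) B
      · exact Or.inr (Or.inl ⟨hB, a2⟩)
      obtain ⟨h4, h5⟩ := h3 a1 a2
      right; right
      rw [if_pos h4, Finset.mem_filter]
      exact ⟨hB, h5⟩
  have h1 := (Finset.card_le_card hcov).trans (Finset.card_union_le _ _)
  have h2 := h1.trans (Nat.add_le_add_left Finset.card_biUnion_le _)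
  rw [Finset.card_powerset] at h2
  have h3 : (2 : ℝ) ^ U.card ≤ ((U.powerset.filter (MidGood (2 * V + 50) N)).card : ℝ) +
      ∑ i ∈ range (N - 2 * V - 50 + 1), (3 * (9 / 10) ^ 50 * 2 ^ U.card) * (9 / 10 : ℝ) ^ i := by
    have h2' := (Nat.cast_le (α := ℝ)).2 h2
    rw [Nat.cast_pow, Nat.cast_ofNat] at h2'
    refine h2'.trans ?_
    push_cast
    gcongr with i hi
    rw [Finset.mem_range] at hi
    have b1 := bound1 V N (2 * V + 50 + i) (50 + i) (by push_cast; ring) (by omega) (by omega)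
    have b2 := bound2 V N (2 * V + 50 + i) (50 + i) (by push_cast; ring) (by omega) (by omega)
    have b3 : ((if (2 * V + 50 + i : ℤ) < N then U.powerset.filter (E3 (N - (2 * V + 50 + i)))
        else ∅).card : ℝ) ≤ (9 / 10) ^ (50 + i) * 2 ^ U.card := by
      split_ifs with hlt
      · exact bound3 V N (2 * V + 50 + i) (50 + i) (by push_cast; ring) hlt (by omega)
      · simp; positivity
    rw [← hU] at b1 b2
    refine (Nat.cast_le.2 ((Finset.card_union_le _ _).trans
      (Nat.add_le_add_left (Finset.card_union_le _ _) _))).trans ?_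
    push_cast
    rw [pow_add] at b1 b2 b3
    linarith
  rw [← Finset.mul_sum] at h3
  have h4 : ∑ i ∈ range (N - 2 * V - 50 + 1), (9 / 10 : ℝ) ^ i ≤ 10 := by
    rw [geom_sum_eq (by norm_num)]
    have : (0:ℝ) ≤ (9 / 10) ^ (N - 2 * V - 50 + 1) := by positivity
    rw [div_le_iff_of_neg (by norm_num)]
    linarith
  have h5 : (0:ℝ) < 2 ^ U.card := by positivity
  have h6 : 3 * (9 / 10 : ℝ) ^ 50 * 2 ^ U.card * ∑ i ∈ range (N - 2 * V - 50 + 1), (9 / 10 : ℝ) ^ i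
      ≤ 3 * (9 / 10 : ℝ) ^ 50 * 2 ^ U.card * 10 := by gcongr
  have h7 : 3 * (9 / 10 : ℝ) ^ 50 * 10 ≤ 1 / 2 := by norm_num
  nlinarith

/-- the two filled pieces -/
noncomputable def EE (V W N : ℤ) : Finset ℤ := Ico V W ∪ Ioc (N - W) (N - V)

/-- the assembled set -/
noncomputable def Phi (V W N : ℤ) (L R B : Finset ℤ) : Finset ℤ :=
  (L ∪ R.image (fun x => N - x)) ∪ (B ∪ EE V W N)

theorem mem_Phi (V W N : ℤ) (L R B : Finset ℤ) (x : ℤ) : x ∈ Phi V W N L R B ↔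
    (x ∈ L ∨ N - x ∈ R) ∨ (x ∈ B ∨ ((V ≤ x ∧ x < W) ∨ (N - W < x ∧ x ≤ N - V))) := by
  have : (∃ a ∈ R, N - a = x) ↔ N - x ∈ R := by
    constructor
    · rintro ⟨a, ha, rfl⟩; simpa using ha
    · intro h; exact ⟨_, h, by ring⟩
  simp only [Phi, EE, Finset.mem_union, Finset.mem_image, Finset.mem_Ico, Finset.mem_Ioc, this]

theorem Phi_GG (V W N : ℤ) (L R B : Finset ℤ) (hV : 0 < V) (hVW : V ≤ W) (hN : 2 * W ≤ N)
    (hL : ∀ x ∈ L, 0 ≤ x ∧ x < V) (hR : ∀ x ∈ R, 0 ≤ x ∧ x < V) (zL : 0 ∈ L) (zR : 0 ∈ R)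
    (hB : B ⊆ Icc V (N - V)) (hg : MidGood W N B) :
    GG V N L R (Phi V W N L R B) ((Phi V W N L R B).image (fun x => N - x)) := by
  have hB' : ∀ x ∈ B, V ≤ x ∧ x ≤ N - V := fun x hx => Finset.mem_Icc.1 (hB hx)
  have hmB : ∀ x ∈ B, x ∈ Phi V W N L R B := fun x hx => (mem_Phi ..).2 (Or.inr (Or.inl hx))
  have h0 : 0 ∈ Phi V W N L R B := (mem_Phi ..).2 (Or.inl (Or.inl zL))
  have hNm : N ∈ Phi V W N L R B := (mem_Phi ..).2 (Or.inl (Or.inr (by simpa using zR)))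
  have hlo : ∀ y, V ≤ y → y < W → y ∈ Phi V W N L R B := fun y h1 h2 =>
    (mem_Phi ..).2 (Or.inr (Or.inr (Or.inl ⟨h1, h2⟩)))
  have hhi : ∀ y, N - W < y → y ≤ N - V → y ∈ Phi V W N L R B := fun y h1 h2 =>
    (mem_Phi ..).2 (Or.inr (Or.inr (Or.inr ⟨h1, h2⟩)))
  have hrange : ∀ x ∈ Phi V W N L R B, 0 ≤ x ∧ x ≤ N := by
    intro x hx
    rcases (mem_Phi ..).1 hx with (h | h) | (h | h)
    · have := hL x h; omega
    · have := hR _ h; omega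
    · have := hB' x h; omega
    · omega
  have hLw : ∀ x, x < V → (x ∈ Phi V W N L R B ↔ x ∈ L) := by
    intro x hx
    rw [mem_Phi]
    constructor
    · rintro ((h | h) | (h | h))
      · exact h
      · have := hR _ h; omega
      · have := hB' x h; omega
      · omega
    · intro h; exact Or.inl (Or.inl h)
  have hRw : ∀ x, x < V → (N - x ∈ Phi V W N L R B ↔ x ∈ R) := by
    intro x hx
    rw [mem_Phi]
    constructor
    · rintro ((h | h) | (h | h))
      · have := hL _ h; omega
      · simpa using h
      · have := hB' _ h; omega
      · omega
    · intro h; exact Or.inl (Or.inr (by simpa using h))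
  have hrf : ∀ x, x ∈ (Phi V W N L R B).image (fun x => N - x) ↔ N - x ∈ Phi V W N L R B := by
    intro x
    rw [Finset.mem_image]
    constructor
    · rintro ⟨a, ha, rfl⟩; simpa using ha
    · intro h; exact ⟨_, h, by ring⟩
  have hss : ∀ y, V ≤ y → y ≤ 2 * N - V →
      ∃ a ∈ Phi V W N L R B, ∃ b ∈ Phi V W N L R B, a + b = y := by
    intro y h1 h2
    by_cases c1 : y < W
    · exact ⟨y, hlo y h1 c1, 0, h0, by ring⟩
    by_cases c2 : y ≤ N
    · have := (hg y (by omega) c2).1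
      unfold E1 at this
      push Not at this
      obtain ⟨a, ha, b, hb, e⟩ := this
      exact ⟨a, hmB a ha, b, hmB b hb, e⟩
    by_cases c3 : y ≤ 2 * N - W
    · have := (hg (2 * N - y) (by omega) (by omega)).2.1
      unfold E1 at this
      push Not at this
      obtain ⟨a, ha, b, hb, e⟩ := this
      exact ⟨a, hmB a ha, b, hmB b hb, by omega⟩
    · exact ⟨N, hNm, y - N, hhi _ (by omega) (by omega), by ring⟩
  exact
  { rf := hrf
    nn := fun x hx => (hrange x hx).1
    nn' := fun x hx => by have := hrange _ ((hrf x).1 hx); omega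
    Ln := fun x hx => (hL x hx).1
    Rn := fun x hx => (hR x hx).1
    hL := hLw
    hR := fun x hx => by rw [hrf, hRw x hx]
    z := h0
    z' := (hrf 0).2 (by simpa using hNm)
    ss := hss
    ss' := fun y h1 h2 => by
      obtain ⟨a, ha, b, hb, e⟩ := hss (2 * N - y) (by omega) (by omega)
      exact ⟨N - a, (hrf _).2 (by simpa using ha), N - b, (hrf _).2 (by simpa using hb), by omega⟩
    dd := fun y h1 h2 => by
      have key : ∃ a ∈ Phi V W N L R B, ∃ b ∈ Phi V W N L R B, a + (N - b) = y := by
        by_cases c1 : y < W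
        · exact ⟨y, hlo y h1 c1, N, hNm, by ring⟩
        by_cases c2 : y < N
        · have := (hg y (by omega) (by omega)).2.2 c2
          unfold E3 at this
          push Not at this
          obtain ⟨a, ha, b, hb, e⟩ := this
          exact ⟨b, hmB b hb, a, hmB a ha, by omega⟩
        by_cases c4 : y = N
        · exact ⟨0, h0, 0, h0, by omega⟩
        by_cases c3 : y ≤ 2 * N - W
        · have := (hg (2 * N - y) (by omega) (by omega)).2.2 (by omega)
          unfold E3 at this
          push Not at this
          obtain ⟨a, ha, b, hb, e⟩ := this
          exact ⟨a, hmB a ha, b, hmB b hb, by omega⟩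
        · exact ⟨y - N, hhi _ (by omega) (by omega), 0, h0, by ring⟩
      obtain ⟨a, ha, b, hb, e⟩ := key
      exact ⟨a, ha, N - b, (hrf _).2 (by simpa using hb), e⟩
    hV := hV
    hN := by omega }

theorem Phi_fiber (V W N : ℤ) (L R B B' : Finset ℤ)
    (hL : ∀ x ∈ L, 0 ≤ x ∧ x < V) (hR : ∀ x ∈ R, 0 ≤ x ∧ x < V)
    (hB : B ⊆ Icc V (N - V))
    (h : Phi V W N L R B = Phi V W N L R B') (h' : B ∩ EE V W N = B' ∩ EE V W N) : B ⊆ B' := by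
  intro x hx
  by_cases hE : x ∈ EE V W N
  · have : x ∈ B' ∩ EE V W N := by rw [← h']; exact Finset.mem_inter.2 ⟨hx, hE⟩
    exact (Finset.mem_inter.1 this).1
  · have h1 : x ∈ Phi V W N L R B' := by
      rw [← h]; exact (mem_Phi ..).2 (Or.inr (Or.inl hx))
    have h2 := Finset.mem_Icc.1 (hB hx)
    simp only [EE, Finset.mem_union, Finset.mem_Ico, Finset.mem_Ioc] at hE
    rcases (mem_Phi ..).1 h1 with (h | h) | (h | h)
    · have := hL x h; omega
    · have := hR _ h; omega
    · exact h
    · exact absurd h hE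

open Classical in
theorem count_good (V N : ℕ) (L R : Finset ℤ) (hV : 0 < V) (hN : 4 * V + 100 ≤ N)
    (hL : ∀ x ∈ L, 0 ≤ x ∧ x < (V : ℤ)) (hR : ∀ x ∈ R, 0 ≤ x ∧ x < (V : ℤ)) (zL : 0 ∈ L) (zR : 0 ∈ R) :
    (1 / 2 ^ (6 * V + 101) : ℝ) * 2 ^ (N + 1) ≤
      (((Icc (0 : ℤ) N).powerset.filter (fun A => ∃ A', GG V N L R A A')).card : ℝ) := by
  set W : ℤ := 2 * V + 50 with hW
  set U := Icc (V : ℤ) (N - V) with hU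
  set G := U.powerset.filter (MidGood W N) with hG
  have hm : (2 : ℝ) ^ U.card ≤ 2 * (G.card : ℝ) := many_good V N (by omega)
  have hGm : ∀ B ∈ G, B ⊆ U ∧ MidGood W N B := by
    intro B hB
    rw [hG, Finset.mem_filter, Finset.mem_powerset] at hB
    exact hB
  have hfib : G.card ≤ 2 ^ (2 * V + 100) * (G.image (Phi V W N L R)).card := by
    apply Finset.card_le_mul_card_image
    intro A _
    have hE : (EE V W N).card ≤ 2 * V + 100 := by
      refine (Finset.card_union_le _ _).trans ?_
      rw [Int.card_Ico, Int.card_Ioc]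
      omega
    have : (G.filter (fun B => Phi V W N L R B = A)).card ≤ ((EE V W N).powerset).card := by
      apply Finset.card_le_card_of_injOn (fun B => B ∩ EE V W N)
      · intro B _
        exact Finset.mem_coe.2 (Finset.mem_powerset.2 Finset.inter_subset_right)
      · intro B hB B' hB' h
        rw [Finset.mem_coe, Finset.mem_filter] at hB hB'
        have e := hB.2.trans hB'.2.symm
        exact Finset.Subset.antisymm
          (Phi_fiber V W N L R B B' hL hR (hGm B hB.1).1 e h)
          (Phi_fiber V W N L R B' B hL hR (hGm B' hB'.1).1 e.symm h.symm)
    rw [Finset.card_powerset] at this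
    exact this.trans (Nat.pow_le_pow_right (by norm_num) hE)
  have himg : (G.image (Phi V W N L R)).card ≤
      ((Icc (0 : ℤ) N).powerset.filter (fun A => ∃ A', GG V N L R A A')).card := by
    apply Finset.card_le_card
    intro A hA
    obtain ⟨B, hB, rfl⟩ := Finset.mem_image.1 hA
    have hgg := Phi_GG V W N L R B (by omega) (by omega) (by omega) hL hR zL zR (hGm B hB).1 (hGm B hB).2
    rw [Finset.mem_filter, Finset.mem_powerset]
    refine ⟨?_, _, hgg⟩
    intro x hx
    rw [Finset.mem_Icc]
    refine ⟨hgg.nn x hx, ?_⟩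
    have := hgg.nn' (N - x) (Finset.mem_image_of_mem _ hx)
    omega
  have hc : U.card + 2 * V = N + 1 := by rw [hU, Int.card_Icc]; omega
  have h1 := hfib.trans (Nat.mul_le_mul_left _ himg)
  have h2 : (G.card : ℝ) ≤ 2 ^ (2 * V + 100) *
      (((Icc (0 : ℤ) N).powerset.filter (fun A => ∃ A', GG V N L R A A')).card : ℝ) := by
    exact_mod_cast h1
  rw [← hc, one_div_mul_eq_div, div_le_iff₀ (by positivity)]
  set X := (((Icc (0 : ℤ) N).powerset.filter (fun A => ∃ A', GG V N L R A A')).card : ℝ)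
  have hX : 0 ≤ X := by positivity
  calc (2 : ℝ) ^ (U.card + 2 * V) = 2 ^ U.card * 2 ^ (2 * V) := pow_add _ _ _
    _ ≤ (2 * (2 ^ (2 * V + 100) * X)) * 2 ^ (2 * V) := by gcongr; linarith
    _ = X * 2 ^ (4 * V + 101) := by ring
    _ ≤ X * 2 ^ (6 * V + 101) := by gcongr <;> norm_num

/-- Iyer–Lazarev–Miller–Zhang: if `s₁+d₁ = s₂+d₂ = k ≥ 2` and `{s₁,d₁} ≠ {s₂,d₂}` as
unordered pairs, then a positive percentage of subsets `A` of `{0,…,n-1}` satisfy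
`|s₁A - d₁A| > |s₂A - d₂A|`. -/
theorem positive_percentage_generalized_comparison
    (s₁ d₁ s₂ d₂ k : ℕ) (hk : 2 ≤ k) (h₁ : s₁ + d₁ = k) (h₂ : s₂ + d₂ = k)
    (hne : ¬((s₁ = s₂ ∧ d₁ = d₂) ∨ (s₁ = d₂ ∧ d₁ = s₂))) :
    0 < Filter.liminf
      (fun n : ℕ =>
        ((((Finset.Icc (0 : ℤ) ((n : ℤ) - 1)).powerset.filter fun A =>
          (foldSum s₂ A - foldSum d₂ A).card < (foldSum s₁ A - foldSum d₁ A).card).card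
            : ℝ) / 2 ^ n))
      Filter.atTop := by
  classical
  obtain ⟨V, L, R, hV, hL, hR, zL, zR, hlt⟩ := choose_LR s₁ d₁ s₂ d₂ k h₁ h₂ hne
  obtain ⟨t, rfl⟩ : ∃ t, k = t + 2 := ⟨k - 2, by omega⟩
  have hc : (0 : ℝ) < 1 / 2 ^ (6 * V + 101) := by positivity
  refine lt_of_lt_of_le hc ?_
  apply Filter.le_liminf_of_le
  · apply Filter.IsBoundedUnder.isCoboundedUnder_ge
    refine ⟨1, Filter.eventually_map.2 (Filter.Eventually.of_forall fun n => ?_)⟩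
    beta_reduce
    rw [div_le_one (by positivity)]
    have h1 := Finset.card_filter_le (Finset.Icc (0 : ℤ) ((n : ℤ) - 1)).powerset (fun A =>
          (foldSum s₂ A - foldSum d₂ A).card < (foldSum s₁ A - foldSum d₁ A).card)
    rw [Finset.card_powerset, Int.card_Icc] at h1
    have h2 : ((n : ℤ) - 1 + 1 - 0).toNat = n := by omega
    rw [h2] at h1
    exact_mod_cast h1
  · filter_upwards [Filter.eventually_ge_atTop (4 * V + 101)] with n hn
    obtain ⟨N, rfl⟩ : ∃ N, n = N + 1 := ⟨n - 1, by omega⟩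
    rw [le_div_iff₀ (by positivity)]
    refine (count_good V N L R hV (by omega) hL hR zL zR).trans ?_
    have e : (((N + 1 : ℕ) : ℤ) - 1) = N := by push_cast; ring
    rw [e]
    apply Nat.cast_le.2
    apply Finset.card_le_card
    intro A hA
    rw [Finset.mem_filter] at hA ⊢
    obtain ⟨hA, A', hgg⟩ := hA
    refine ⟨hA, ?_⟩
    rw [hgg.card s₁ d₁ t h₁, hgg.card s₂ d₂ t h₂]
    omega
end
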